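/- arXiv:0712.2378 — 17 statements merged into one kernel-verified Lean document; each statement's English description precedes it below -/
import Mathlib

section
/- Let B be a complete Boolean algebra. The following are equivalent: (1) B is σ-distributive; (2) for every sequence of countable covers of B there exists a (possibly uncountable) cover of B refined from the sequence; (3) for every sequence of finite covers of B there exists a cover of B refined from the sequence; (4) for every sequence of two-element partitions of B there exists a cover of B refined from the sequence. -/
/-- A complete Boolean algebra is σ-distributive. -/
def SigmaDistributive (B : Type*) [CompleteBooleanAlgebra B] : Prop :=
  ∀ b : ℕ → ℕ → B, (⨅ n, ⨆ m, b n m) = ⨆ f : ℕ → ℕ, ⨅ n, b n (f n)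

/-- A cover of `B` is a subset whose supremum is `⊤`. -/
def IsBooleanCover {B : Type*} [CompleteBooleanAlgebra B] (C : Set B) : Prop :=
  sSup C = ⊤

/-- A cover `D` is refined from the sequence `C` of covers if every element of `D`
is below some element of each `C n`. -/
def RefinedFromSeq {B : Type*} [CompleteBooleanAlgebra B] (D : Set B) (C : ℕ → Set B) : Prop :=
  ∀ x ∈ D, ∀ n, ∃ c ∈ C n, x ≤ c

theorem sigmaDistributive_tfae_covers {B : Type*} [CompleteBooleanAlgebra B] :
    List.TFAE
      [SigmaDistributive B,
       ∀ C : ℕ → Set B, (∀ n, IsBooleanCover (C n) ∧ (C n).Countable) →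
         ∃ D : Set B, IsBooleanCover D ∧ RefinedFromSeq D C,
       ∀ C : ℕ → Set B, (∀ n, IsBooleanCover (C n) ∧ (C n).Finite) →
         ∃ D : Set B, IsBooleanCover D ∧ RefinedFromSeq D C,
       ∀ C : ℕ → Set B, (∀ n, ∃ a b : B, a ⊓ b = ⊥ ∧ a ⊔ b = ⊤ ∧ C n = {a, b}) →
         ∃ D : Set B, IsBooleanCover D ∧ RefinedFromSeq D C] := by
  tfae_have 1 → 2 := by
    intro h C hC
    by_cases hs : (⊥ : B) = ⊤
    · exact ⟨∅, by simpa [IsBooleanCover] using hs, by intro x hx; exact hx.elim⟩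
    have hne : ∀ n, (C n).Nonempty := by
      intro n
      by_contra hn
      rw [Set.not_nonempty_iff_eq_empty] at hn
      have := (hC n).1
      rw [hn, IsBooleanCover, sSup_empty] at this
      exact hs this
    have hen : ∀ n, ∃ g : ℕ → B, C n = Set.range g := fun n =>
      (hC n).2.exists_eq_range (hne n)
    choose b hb using hen
    refine ⟨Set.range (fun f : ℕ → ℕ => ⨅ n, b n (f n)), ?_, ?_⟩
    · have h1 : ∀ n, (⨆ m, b n m) = ⊤ := by
        intro n
        have := (hC n).1
        rwa [hb n, IsBooleanCover, sSup_range] at this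
      rw [IsBooleanCover, sSup_range, ← h b]
      simp [h1]
    · rintro x ⟨f, rfl⟩ n
      exact ⟨b n (f n), by rw [hb n]; exact ⟨f n, rfl⟩, iInf_le _ n⟩
  tfae_have 2 → 3 := fun h C hC => h C fun n => ⟨(hC n).1, (hC n).2.countable⟩
  tfae_have 3 → 4 := by
    intro h C hC
    refine h C fun n => ?_
    obtain ⟨x, y, -, hxy, hn⟩ := hC n
    rw [hn]
    exact ⟨by rw [IsBooleanCover, sSup_pair, hxy], Set.toFinite _⟩
  tfae_have 4 → 1 := by
    intro h b
    apply le_antisymm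
    · obtain ⟨D, hD, hR⟩ := h
        (fun k => {b k.unpair.1 k.unpair.2, (b k.unpair.1 k.unpair.2)ᶜ})
        (fun k => ⟨_, _, inf_compl_eq_bot, sup_compl_eq_top, rfl⟩)
      have hR' : ∀ d ∈ D, ∀ n m, d ≤ b n m ∨ d ≤ (b n m)ᶜ := by
        intro d hd n m
        obtain ⟨c, hc, hdc⟩ := hR d hd (Nat.pair n m)
        simp only [Nat.unpair_pair] at hc
        rcases hc with rfl | rfl
        · exact Or.inl hdc
        · exact Or.inr hdc
      rw [← inf_top_eq (⨅ n, ⨆ m, b n m), ← show sSup D = ⊤ from hD, inf_sSup_eq]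
      refine iSup₂_le fun d hd => ?_
      by_cases hc : ∀ n, ∃ m, d ≤ b n m
      · choose f hf using hc
        exact inf_le_right.trans
          ((le_iInf hf).trans (le_iSup (fun f : ℕ → ℕ => ⨅ n, b n (f n)) f))
      · push Not at hc
        obtain ⟨n, hn⟩ := hc
        have h2 : (⨆ m, b n m) ≤ dᶜ := iSup_le fun m =>
          le_compl_comm.mp ((hR' d hd n m).resolve_left (hn m))
        calc _ ≤ dᶜ ⊓ d := inf_le_inf_right d ((iInf_le _ n).trans h2)
          _ = ⊥ := compl_inf_self d
          _ ≤ _ := bot_le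
    · exact iSup_le fun f => le_iInf fun n => (iInf_le _ n).trans (le_iSup (b n) (f n))
  tfae_finish
end

section
/- Let B be a complete Boolean algebra. The following are equivalent: (1) B is σ-distributive; (2) for every sequence of countable partitions of B there exists a (possibly uncountable) partition of B refined from the sequence; (3) for every sequence of finite partitions of B there exists a partition of B refined from the sequence; (4) for every sequence of two-element partitions of B there exists a partition of B refined from the sequence. -/
/-- A partition of `B`: a family of pairwise disjoint elements with supremum `⊤`. -/
def IsBooleanPartition {B : Type*} [CompleteBooleanAlgebra B] (P : Set B) : Prop :=
  sSup P = ⊤ ∧ ∀ x ∈ P, ∀ y ∈ P, x ≠ y → x ⊓ y = ⊥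

theorem sigmaDistributive_tfae_partitions {B : Type*} [CompleteBooleanAlgebra B] :
    List.TFAE
      [SigmaDistributive B,
       ∀ C : ℕ → Set B, (∀ n, IsBooleanPartition (C n) ∧ (C n).Countable) →
         ∃ D : Set B, IsBooleanPartition D ∧ RefinedFromSeq D C,
       ∀ C : ℕ → Set B, (∀ n, IsBooleanPartition (C n) ∧ (C n).Finite) →
         ∃ D : Set B, IsBooleanPartition D ∧ RefinedFromSeq D C,
       ∀ C : ℕ → Set B, (∀ n, ∃ a b : B, a ⊓ b = ⊥ ∧ a ⊔ b = ⊤ ∧ C n = {a, b}) →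
         ∃ D : Set B, IsBooleanPartition D ∧ RefinedFromSeq D C] := by
  tfae_have 1 → 2 := by
    intro h C hC
    by_cases hne : ∀ n, (C n).Nonempty
    · have he : ∀ n, ∃ e : ℕ → B, C n = Set.range e := fun n =>
        (hC n).2.exists_eq_range (hne n)
      choose e he using he
      have hmem : ∀ n m, e n m ∈ C n := fun n m => by
        rw [he n]; exact ⟨m, rfl⟩
      refine ⟨Set.range fun f : ℕ → ℕ => ⨅ n, e n (f n), ⟨?_, ?_⟩, ?_⟩
      · rw [sSup_range, ← h e]
        have : ∀ n, (⨆ m, e n m) = ⊤ := fun n => by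
          rw [← sSup_range, ← he n]; exact (hC n).1.1
        simp [this]
      · rintro _ ⟨f, rfl⟩ _ ⟨g, rfl⟩ hfg
        have : ∃ n, e n (f n) ≠ e n (g n) := by
          by_contra! hcon
          exact hfg (iInf_congr hcon)
        obtain ⟨n, hn⟩ := this
        rw [eq_bot_iff, ← (hC n).1.2 _ (hmem n (f n)) _ (hmem n (g n)) hn]
        exact inf_le_inf (iInf_le (fun n => e n (f n)) n) (iInf_le (fun n => e n (g n)) n)
      · rintro _ ⟨f, rfl⟩ n
        exact ⟨_, hmem n (f n), iInf_le (fun n => e n (f n)) n⟩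
    · push Not at hne
      obtain ⟨n, hn⟩ := hne
      have h1 := (hC n).1.1
      rw [hn] at h1
      exact ⟨∅, ⟨h1, fun x hx => hx.elim⟩, fun x hx => hx.elim⟩
  tfae_have 2 → 3 := fun h C hC => h C fun n => ⟨(hC n).1, (hC n).2.countable⟩
  tfae_have 3 → 4 := by
    intro h C hC
    refine h C fun n => ?_
    obtain ⟨a, b, hab, hab', hn⟩ := hC n
    rw [hn]
    refine ⟨⟨by rw [sSup_pair, hab'], ?_⟩, Set.toFinite _⟩
    rintro x (rfl | rfl) y (rfl | rfl) hxy
    · exact (hxy rfl).elim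
    · exact hab
    · rw [inf_comm]; exact hab
    · exact (hxy rfl).elim
  tfae_have 4 → 1 := by
    intro h b
    apply le_antisymm
    · obtain ⟨D, ⟨hD, -⟩, hr⟩ := h
        (fun k => {b k.unpair.1 k.unpair.2, (b k.unpair.1 k.unpair.2)ᶜ})
        (fun k => ⟨_, _, inf_compl_eq_bot, sup_compl_eq_top, rfl⟩)
      have hr' : ∀ d ∈ D, ∀ n m, d ≤ b n m ∨ d ≤ (b n m)ᶜ := by
        intro d hd n m
        obtain ⟨c, hc, hdc⟩ := hr d hd (Nat.pair n m)
        simp only [Nat.unpair_pair] at hc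
        rcases hc with rfl | rfl
        · exact Or.inl hdc
        · exact Or.inr hdc
      rw [← inf_top_eq (⨅ n, ⨆ m, b n m), ← hD, inf_sSup_eq]
      refine iSup₂_le fun d hd => ?_
      by_cases hf : ∀ n, ∃ m, d ≤ b n m
      · choose f hf using hf
        exact inf_le_right.trans ((le_iInf hf).trans
          (le_iSup (fun f : ℕ → ℕ => ⨅ n, b n (f n)) f))
      · push Not at hf
        obtain ⟨n, hn⟩ := hf
        have h1 : d ≤ (⨆ m, b n m)ᶜ := by
          rw [compl_iSup]
          exact le_iInf fun m => (hr' d hd n m).resolve_left (hn m)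
        have h2 := inf_le_inf (iInf_le (fun n => ⨆ m, b n m) n) h1
        rw [inf_compl_eq_bot] at h2
        exact h2.trans bot_le
    · exact iSup_le fun f => iInf_mono fun n => le_iSup (b n) (f n)
  tfae_finish
end

section
/- Let Q be an extremally disconnected compact Hausdorff space. For every sequence (Cₙ) of finite covers of Q by clopen sets (each Cₙ is a finite family of clopen subsets of Q whose union is Q), there exists a continuous function g : Q → ℝ refined from the sequence; that is, for every n ∈ ℕ and all points q′, q″ ∈ Q with g(q′) = g(q″) there is a member U of Cₙ containing both q′ and q″. -/
/-- Lemma 1.3.6: on the Stone space of a complete Boolean algebra (an extremally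
disconnected compact Hausdorff space), for every sequence of finite clopen covers
there is a continuous real function refined from the sequence. -/
theorem exists_continuous_refined_from_finite_clopen_covers
    {Q : Type*} [TopologicalSpace Q] [CompactSpace Q] [T2Space Q]
    [ExtremallyDisconnected Q]
    (C : ℕ → Set (Set Q))
    (hfin : ∀ n, (C n).Finite)
    (hclopen : ∀ n, ∀ U ∈ C n, IsClopen U)
    (hcover : ∀ n, ⋃₀ C n = Set.univ) :
    ∃ g : Q → ℝ, Continuous g ∧
      ∀ n, ∀ q q' : Q, g q = g q' → ∃ U ∈ C n, q ∈ U ∧ q' ∈ U := by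
  classical
  have hc : (insert ∅ (⋃ n, C n)).Countable :=
    (Set.countable_iUnion fun n => (hfin n).countable).insert ∅
  obtain ⟨f, hf⟩ := hc.exists_eq_range (Set.insert_nonempty _ _)
  have hfc : ∀ k, IsClopen (f k) := by
    intro k
    have hk : f k ∈ insert ∅ (⋃ n, C n) := hf ▸ Set.mem_range_self k
    rcases hk with hk | hk
    · rw [hk]; exact isClopen_empty
    · obtain ⟨n, hn⟩ := Set.mem_iUnion.1 hk
      exact hclopen n _ hn
  let F : Q → ℕ → Bool := fun q k => (f k).boolIndicator q
  have hF : Continuous F :=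
    continuous_pi fun k => (continuous_boolIndicator_iff_isClopen (f k)).2 (hfc k)
  refine ⟨fun q => (cantorSetHomeomorphNatToBool.symm (F q) : ℝ),
    continuous_subtype_val.comp (cantorSetHomeomorphNatToBool.symm.continuous.comp hF), ?_⟩
  intro n q q' h
  have h' : F q = F q' := cantorSetHomeomorphNatToBool.symm.injective (Subtype.ext h)
  have hq : q ∈ ⋃₀ C n := by rw [hcover n]; trivial
  obtain ⟨U, hU, hqU⟩ := hq
  refine ⟨U, hU, hqU, ?_⟩
  have hUr : U ∈ Set.range f := hf ▸ Set.mem_insert_of_mem _ (Set.mem_iUnion.2 ⟨n, hU⟩)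
  obtain ⟨k, rfl⟩ := hUr
  have hk : (f k).boolIndicator q = (f k).boolIndicator q' := congrFun h' k
  rw [Set.mem_iff_boolIndicator] at hqU ⊢
  rw [← hk, hqU]
end

section
/- Let Q be an extremally disconnected compact Hausdorff space. The following are equivalent: (a) for every sequence of countable families of pairwise disjoint clopen subsets of Q with dense union, there exists a family of pairwise disjoint clopen subsets of Q with dense union each member of which is contained in some member of each given family (this expresses σ-distributivity of the complete Boolean algebra of clopen subsets of Q); (b) for every continuous function g : Q → ℝ there exists a family of pairwise disjoint clopen subsets of Q with dense union such that g is constant on each member of the family. -/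
/-- Theorem 1.3.7 in topological form: for an extremally disconnected compact
Hausdorff space `Q`, σ-distributivity of the Boolean algebra of clopen sets
(expressed via refinement of sequences of countable disjoint clopen families with
dense union) is equivalent to every continuous real function on `Q` being constant
on each member of some disjoint clopen family with dense union. -/
theorem clopen_sigmaDistributive_iff_locally_one_dimensional
    {Q : Type*} [TopologicalSpace Q] [CompactSpace Q] [T2Space Q]
    [ExtremallyDisconnected Q] :
    (∀ F : ℕ → Set (Set Q),
        (∀ n, (F n).Countable ∧ (∀ U ∈ F n, IsClopen U) ∧
          ((F n).Pairwise fun U V => U ∩ V = ∅) ∧ Dense (⋃₀ F n)) →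
        ∃ D : Set (Set Q), (∀ U ∈ D, IsClopen U) ∧
          (D.Pairwise fun U V => U ∩ V = ∅) ∧ Dense (⋃₀ D) ∧
          ∀ U ∈ D, ∀ n, ∃ V ∈ F n, U ⊆ V)
      ↔
      (∀ g : Q → ℝ, Continuous g →
        ∃ D : Set (Set Q), (∀ U ∈ D, IsClopen U) ∧
          (D.Pairwise fun U V => U ∩ V = ∅) ∧ Dense (⋃₀ D) ∧
          ∀ U ∈ D, ∀ q ∈ U, ∀ q' ∈ U, g q = g q') := by
  classical
  constructor
  · intro h g hg
    obtain ⟨e, he⟩ := exists_surjective_nat ℚ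
    have hC : ∀ r : ℝ, IsClopen (closure {q | g q < r}) := fun r =>
      ⟨isClosed_closure, ExtremallyDisconnected.open_closure _ (isOpen_lt hg continuous_const)⟩
    obtain ⟨D, h1, h2, h3, h4⟩ := h
      (fun n => {closure {q | g q < (e n : ℝ)}, (closure {q | g q < (e n : ℝ)})ᶜ}) (by
        intro n
        refine ⟨(Set.toFinite _).countable, ?_, ?_, ?_⟩
        · rintro U (rfl | rfl)
          · exact hC _
          · exact (hC _).compl
        · rintro U (rfl | rfl) V (rfl | rfl) hUV
          · exact absurd rfl hUV
          · exact Set.inter_compl_self _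
          · exact Set.compl_inter_self _
          · exact absurd rfl hUV
        · rw [Set.sUnion_pair, Set.union_compl_self]
          exact dense_univ)
    refine ⟨D, h1, h2, h3, ?_⟩
    have key : ∀ U ∈ D, ∀ q ∈ U, ∀ q' ∈ U, ¬ g q < g q' := by
      intro U hU q hq q' hq' hlt
      obtain ⟨r, hr1, hr2⟩ := exists_rat_btwn hlt
      obtain ⟨n, rfl⟩ := he r
      have hin : q ∈ closure {q | g q < (e n : ℝ)} := subset_closure hr1
      have hout : q' ∉ closure {q | g q < (e n : ℝ)} := fun hc =>
        absurd (closure_lt_subset_le hg continuous_const hc) (not_le.mpr hr2)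
      obtain ⟨V, (rfl | rfl), hUV⟩ := h4 U hU n
      · exact hout (hUV hq')
      · exact hUV hq hin
    intro U hU q hq q' hq'
    exact le_antisymm (not_lt.mp (key U hU q' hq' q hq)) (not_lt.mp (key U hU q hq q' hq'))
  · intro h F hF
    have hcount : (insert ∅ (⋃ n, F n)).Countable :=
      (Set.countable_iUnion fun n => (hF n).1).insert _
    obtain ⟨V, hV⟩ := hcount.exists_eq_range (Set.insert_nonempty _ _)
    have hVc : ∀ m, IsClopen (V m) := by
      intro m
      have hm : V m ∈ insert ∅ (⋃ n, F n) := hV ▸ Set.mem_range_self m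
      rcases hm with hm | hm
      · rw [hm]; exact isClopen_empty
      · obtain ⟨n, hn⟩ := Set.mem_iUnion.mp hm
        exact (hF n).2.1 _ hn
    let g : Q → ℝ := fun q => Cardinal.cantorFunction (1/3) (fun m => decide (q ∈ V m))
    have hg : Continuous g := by
      have hs : Summable (fun m : ℕ => ((1/3 : ℝ)) ^ m) :=
        summable_geometric_of_lt_one (by norm_num) (by norm_num)
      refine continuous_tsum (u := fun m : ℕ => ((1/3 : ℝ)) ^ m) ?_ hs ?_
      · intro m
        have : (fun q => Cardinal.cantorFunctionAux (1/3) (fun m => decide (q ∈ V m)) m)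
            = (V m).indicator (fun _ => ((1/3 : ℝ)) ^ m) := by
          funext q
          by_cases hq : q ∈ V m <;> simp [Cardinal.cantorFunctionAux, hq]
        rw [this]
        exact continuous_const.indicator (fun a ha => by simp [(hVc m).frontier_eq] at ha)
      · intro m q
        by_cases hq : q ∈ V m <;> simp [Cardinal.cantorFunctionAux, hq]
    obtain ⟨D, h1, h2, h3, h4⟩ := h g hg
    refine ⟨D \ {∅}, fun U hU => h1 U hU.1, h2.mono Set.diff_subset, ?_, ?_⟩
    · rwa [Set.sUnion_diff_singleton_empty]
    · rintro U ⟨hU, hne⟩ n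
      have hne' : U.Nonempty := Set.nonempty_iff_ne_empty.mpr hne
      obtain ⟨q, hqU, W, hW, hqW⟩ := (hF n).2.2.2.inter_open_nonempty U (h1 U hU).2 hne'
      refine ⟨W, hW, fun q' hq' => ?_⟩
      have hWr : W ∈ Set.range V := hV ▸ Set.mem_insert_of_mem _ (Set.mem_iUnion.mpr ⟨n, hW⟩)
      obtain ⟨m, rfl⟩ := hWr
      have hinj := Cardinal.cantorFunction_injective (c := 1/3) (by norm_num) (by norm_num)
        (h4 U hU q hqU q' hq')
      have := congrFun hinj m
      simpa [hqW] using this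
end

section
/- Let B be a complete Boolean algebra and let S be a Boolean subalgebra of B (a subset containing ⊥ and ⊤ and closed under ⊓, ⊔, and complementation) that is dense and σ-inductive. Then B is σ-distributive. -/
/-- Lemma 1.3.9: if a complete Boolean algebra has a dense σ-inductive subalgebra,
then it is σ-distributive. -/
theorem sigmaDistributive_of_dense_sigmaInductive_subalgebra
    {B : Type*} [CompleteBooleanAlgebra B] (S : Set B)
    (hbot : ⊥ ∈ S) (htop : ⊤ ∈ S)
    (hinf : ∀ x ∈ S, ∀ y ∈ S, x ⊓ y ∈ S)
    (hsup : ∀ x ∈ S, ∀ y ∈ S, x ⊔ y ∈ S)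
    (hcompl : ∀ x ∈ S, xᶜ ∈ S)
    (hdense : ∀ b : B, b ≠ ⊥ → ∃ s ∈ S, s ≠ ⊥ ∧ s ≤ b)
    (hind : ∀ s : ℕ → B, (∀ n, s n ∈ S) → (∀ n, s (n + 1) ≤ s n) → (∀ n, s n ≠ ⊥) →
      ∃ t ∈ S, t ≠ ⊥ ∧ ∀ n, t ≤ s n) :
    ∀ b : ℕ → ℕ → B, (⨅ n, ⨆ m, b n m) = ⨆ f : ℕ → ℕ, ⨅ n, b n (f n) := by
  intro b
  apply le_antisymm
  swap
  · exact iSup_le fun f => iInf_mono fun n => le_iSup (b n) (f n)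
  by_contra hle
  have hc : (⨅ n, ⨆ m, b n m) ⊓ (⨆ f : ℕ → ℕ, ⨅ n, b n (f n))ᶜ ≠ ⊥ := by
    intro h
    apply hle
    rw [← sdiff_eq] at h
    exact sdiff_eq_bot_iff.mp h
  obtain ⟨s₀, hs₀S, hs₀, hs₀c⟩ := hdense _ hc
  have step : ∀ (n : ℕ) (s : {s : B // s ∈ S ∧ s ≠ ⊥ ∧ s ≤ s₀}),
      ∃ (s' : {s : B // s ∈ S ∧ s ≠ ⊥ ∧ s ≤ s₀}) (m : ℕ), s'.1 ≤ s.1 ∧ s'.1 ≤ b n m := by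
    rintro n ⟨s, hsS, hs, hss⟩
    have h1 : s ≤ ⨆ m, b n m :=
      (hss.trans hs₀c).trans (inf_le_left.trans (iInf_le _ n))
    have h2 : ∃ m, s ⊓ b n m ≠ ⊥ := by
      by_contra hno
      push Not at hno
      apply hs
      rw [← inf_eq_left.mpr h1, inf_iSup_eq]
      simp [hno]
    obtain ⟨m, hm⟩ := h2
    obtain ⟨s', h', h'', h3⟩ := hdense _ hm
    exact ⟨⟨s', h', h'', (h3.trans inf_le_left).trans hss⟩, m, h3.trans inf_le_left,
      h3.trans inf_le_right⟩
  choose g k hg hk using step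
  let u : ℕ → {s : B // s ∈ S ∧ s ≠ ⊥ ∧ s ≤ s₀} :=
    fun n => Nat.rec ⟨s₀, hs₀S, hs₀, le_rfl⟩ (fun n s => g n s) n
  obtain ⟨t, -, ht, htu⟩ := hind (fun n => (u n).1) (fun n => (u n).2.1)
    (fun n => hg n (u n)) (fun n => (u n).2.2.1)
  apply ht
  have h1 : t ≤ ⨆ f : ℕ → ℕ, ⨅ n, b n (f n) :=
    le_trans (le_iInf fun n => (htu (n + 1)).trans (hk n (u n)))
      (le_iSup (fun f : ℕ → ℕ => ⨅ n, b n (f n)) (fun n => k n (u n)))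
  have h2 : t ≤ (⨆ f : ℕ → ℕ, ⨅ n, b n (f n))ᶜ :=
    ((htu 0).trans hs₀c).trans inf_le_right
  exact le_bot_iff.mp ((le_inf h1 h2).trans inf_compl_eq_bot.le)
end

section
/- There exists a complete Boolean algebra B that is nontrivial (⊥ ≠ ⊤), atomless (B has no atoms), and σ-distributive. -/
open Heyting

/-- Countable partial functions from the reals to the Booleans, given by graphs. -/
def CohenCond : Type :=
  {s : Set (ℝ × Bool) // s.Countable ∧ ∀ x, ¬ ((x, true) ∈ s ∧ (x, false) ∈ s)}

/-- Stronger conditions are smaller. -/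
instance : PartialOrder CohenCond where
  le p q := q.1 ⊆ p.1
  le_refl p := subset_rfl
  le_trans p q r h1 h2 := fun _ hx => h1 (h2 hx)
  le_antisymm p q h1 h2 := Subtype.ext (Set.Subset.antisymm h2 h1)

theorem CohenCond.le_def (p q : CohenCond) : p ≤ q ↔ q.1 ⊆ p.1 := Iff.rfl

theorem CohenCond.closed (p : ℕ → CohenCond) (hp : ∀ n, p (n + 1) ≤ p n) :
    ∃ q, ∀ n, q ≤ p n := by
  have hanti : Antitone p := antitone_nat_of_succ_le hp
  refine ⟨⟨⋃ n, (p n).1, Set.countable_iUnion fun n => (p n).2.1, ?_⟩, ?_⟩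
  · rintro x ⟨h1, h2⟩
    obtain ⟨i, hi⟩ := Set.mem_iUnion.1 h1
    obtain ⟨j, hj⟩ := Set.mem_iUnion.1 h2
    exact (p (max i j)).2.2 x ⟨hanti (le_max_left i j) hi, hanti (le_max_right i j) hj⟩
  · intro n
    exact Set.subset_iUnion (fun n => (p n).1) n

theorem CohenCond.split (p : CohenCond) :
    ∃ q r, q ≤ p ∧ r ≤ p ∧ ∀ t, t ≤ q → t ≤ r → False := by
  have hc : (Prod.fst '' p.1).Countable := p.2.1.image _
  obtain ⟨x, hx⟩ : ∃ x, x ∉ Prod.fst '' p.1 := by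
    by_contra! h
    exact Set.not_countable_univ (hc.mono fun x _ => h x)
  have hx' : ∀ b, (x, b) ∉ p.1 := fun b hb => hx ⟨_, hb, rfl⟩
  have key : ∀ b, ∀ y, ¬ ((y, true) ∈ insert (x, b) p.1 ∧ (y, false) ∈ insert (x, b) p.1) := by
    rintro b y ⟨h1, h2⟩
    have h0 := p.2.2 y
    simp only [Set.mem_insert_iff, Prod.mk.injEq] at h1 h2
    rcases h1 with ⟨rfl, rfl⟩ | h1
    · rcases h2 with ⟨_, h⟩ | h2
      · cases h
      · exact hx' _ h2
    · rcases h2 with ⟨rfl, rfl⟩ | h2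
      · exact hx' _ h1
      · exact h0 ⟨h1, h2⟩
  refine ⟨⟨insert (x, true) p.1, p.2.1.insert _, key true⟩,
    ⟨insert (x, false) p.1, p.2.1.insert _, key false⟩,
    Set.subset_insert _ _, Set.subset_insert _ _, ?_⟩
  intro t h1 h2
  exact t.2.2 x ⟨h1 (Set.mem_insert _ _), h2 (Set.mem_insert _ _)⟩

theorem LowerSet.mem_himp_compl {P : Type} [PartialOrder P] (a : LowerSet P) (x : P) :
    x ∈ (aᶜ : LowerSet P) ↔ ∀ y ≤ x, y ∉ a := by
  rw [← LowerSet.Iic_le, le_compl_iff_disjoint_right, disjoint_iff_inf_le]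
  constructor
  · intro h y hy hya
    exact h (show y ∈ LowerSet.Iic x ⊓ a from ⟨hy, hya⟩)
  · rintro h y ⟨hy, hya⟩
    exact (h y hy hya).elim

/-- The regular open algebra of a frame is complete. -/
noncomputable def regularCBA (α : Type) [Order.Frame α] : CompleteBooleanAlgebra (Regular α) :=
  { (inferInstance : BooleanAlgebra (Regular α)) with
    sSup := (Regular.gi (α := α)).liftCompleteLattice.sSup
    sInf := (Regular.gi (α := α)).liftCompleteLattice.sInf
    isLUB_sSup := (Regular.gi (α := α)).liftCompleteLattice.isLUB_sSup
    isGLB_sInf := (Regular.gi (α := α)).liftCompleteLattice.isGLB_sInf }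

/-- The canonical map from a poset to its regular open algebra. -/
def regEmb {P : Type} [PartialOrder P] (p : P) : Regular (LowerSet P) :=
  Regular.toRegular (LowerSet.Iic p)

theorem mem_regEmb {P : Type} [PartialOrder P] (p r : P) :
    r ∈ (regEmb p : LowerSet P) ↔ ∀ s ≤ r, ∃ q ≤ s, q ≤ p := by
  unfold regEmb
  rw [Regular.coe_toRegular, LowerSet.mem_himp_compl]
  simp only [LowerSet.mem_himp_compl, LowerSet.mem_Iic_iff, not_forall, not_not, exists_prop]

theorem regEmb_le_iff {P : Type} [PartialOrder P] (p : P) (a : Regular (LowerSet P)) :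
    regEmb p ≤ a ↔ p ∈ (a : LowerSet P) := by
  unfold regEmb
  rw [Regular.gi.gc, LowerSet.Iic_le]

theorem exists_mem_of_ne_bot {P : Type} [PartialOrder P] (a : Regular (LowerSet P))
    (h : a ≠ ⊥) : ∃ p, p ∈ (a : LowerSet P) := by
  by_contra! hn
  apply h
  apply le_bot_iff.1
  rw [← Regular.coe_le_coe]
  intro p hp
  exact (hn p hp).elim

theorem regEmb_ne_bot {P : Type} [PartialOrder P] (p : P) : regEmb p ≠ ⊥ := by
  intro h
  have := (regEmb_le_iff p _).1 h.le
  exact this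

theorem regEmb_refine {P : Type} [PartialOrder P] (p : P) (a : Regular (LowerSet P))
    (h : regEmb p ⊓ a ≠ ⊥) : ∃ q ≤ p, regEmb q ≤ a := by
  obtain ⟨r, hr1, hr2⟩ := exists_mem_of_ne_bot _ h
  obtain ⟨q, hq, hqp⟩ := (mem_regEmb p r).1 hr1 r le_rfl
  exact ⟨q, hqp, (regEmb_le_iff q a).2 (LowerSet.lower _ hq hr2)⟩

theorem sigmaDistrib_aux {P B : Type} [PartialOrder P] [CompleteBooleanAlgebra B] (e : P → B)
    (emono : Monotone e) (e0 : ∀ p, e p ≠ ⊥) (edense : ∀ a, a ≠ ⊥ → ∃ p, e p ≤ a)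
    (eref : ∀ p a, e p ⊓ a ≠ ⊥ → ∃ q ≤ p, e q ≤ a)
    (hclosed : ∀ p : ℕ → P, (∀ n, p (n + 1) ≤ p n) → ∃ q, ∀ n, q ≤ p n)
    (b : ℕ → ℕ → B) : (⨅ n, ⨆ m, b n m) = ⨆ f : ℕ → ℕ, ⨅ n, b n (f n) := by
  apply le_antisymm
  · by_contra hle
    have hne : (⨅ n, ⨆ m, b n m) ⊓ (⨆ f : ℕ → ℕ, ⨅ n, b n (f n))ᶜ ≠ ⊥ := by
      intro h
      exact hle (disjoint_compl_right_iff.1 (disjoint_iff.2 h))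
    obtain ⟨p0, hp0⟩ := edense _ hne
    have step : ∀ (n : ℕ) (p : P), ∃ q : P, ∃ m, p ≤ p0 → q ≤ p ∧ e q ≤ b n m := by
      intro n p
      by_cases hp : p ≤ p0
      · have h1 : e p ≤ ⨆ m, b n m :=
          (emono hp).trans (hp0.trans (inf_le_left.trans (iInf_le _ n)))
        have h2 : ∃ m, e p ⊓ b n m ≠ ⊥ := by
          by_contra! h
          apply e0 p
          rw [← inf_eq_left.2 h1, inf_iSup_eq]
          simp [h]
        obtain ⟨m, hm⟩ := h2
        obtain ⟨q, hq, hqb⟩ := eref _ _ hm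
        exact ⟨q, m, fun _ => ⟨hq, hqb⟩⟩
      · exact ⟨p, 0, fun h => (hp h).elim⟩
    choose g m hg using step
    let s : ℕ → P := fun n => Nat.rec p0 (fun n p => g n p) n
    have hs : ∀ n, s (n + 1) = g n (s n) := fun n => rfl
    have hs0 : ∀ n, s n ≤ p0 := by
      intro n
      induction n with
      | zero => exact le_rfl
      | succ n ih => rw [hs]; exact (hg n _ ih).1.trans ih
    obtain ⟨q, hq⟩ := hclosed s (fun n => by rw [hs]; exact (hg n _ (hs0 n)).1)
    have h1 : e q ≤ ⨆ f : ℕ → ℕ, ⨅ n, b n (f n) := by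
      refine le_trans ?_ (le_iSup _ (fun n => m n (s n)))
      refine le_iInf fun n => ?_
      refine (emono (hq (n + 1))).trans ?_
      rw [hs]
      exact (hg n _ (hs0 n)).2
    have h2 : e q ≤ (⨆ f : ℕ → ℕ, ⨅ n, b n (f n))ᶜ :=
      (emono (hq 0)).trans (hp0.trans inf_le_right)
    apply e0 q
    apply le_bot_iff.1
    rw [← inf_compl_eq_bot]
    exact le_inf h1 h2
  · exact iSup_le fun f => le_iInf fun n => (iInf_le _ n).trans (le_iSup (b n) (f n))

/-- Theorem 1.3.8 (Boolean algebra form): there exists a nontrivial atomless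
σ-distributive complete Boolean algebra. -/
theorem exists_atomless_sigmaDistributive_completeBooleanAlgebra :
    ∃ (B : Type) (inst : CompleteBooleanAlgebra B),
      (⊥ : B) ≠ ⊤ ∧ (∀ a : B, ¬ IsAtom a) ∧
      ∀ b : ℕ → ℕ → B, (⨅ n, ⨆ m, b n m) = ⨆ f : ℕ → ℕ, ⨅ n, b n (f n) := by
  refine ⟨Regular (LowerSet CohenCond), regularCBA _, ?_, ?_, ?_⟩
  · intro h
    let p : CohenCond := ⟨∅, Set.countable_empty, fun x h => h.1⟩
    have h1 : regEmb p ≤ (⊤ : Regular (LowerSet CohenCond)) := le_top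
    exact regEmb_ne_bot p (le_bot_iff.1 (h1.trans (le_of_eq h.symm)))
  · intro a ha
    obtain ⟨p, hp⟩ := exists_mem_of_ne_bot a ha.1
    obtain ⟨q, r, hq, hr, hqr⟩ := p.split
    have key : ∀ t, t ≤ p → regEmb t = a := by
      intro t ht
      have hle : regEmb t ≤ a := (regEmb_le_iff t a).2 (LowerSet.lower _ ht hp)
      by_contra hne
      exact regEmb_ne_bot t (ha.2 _ (lt_of_le_of_ne hle hne))
    have h1 : regEmb r ≤ regEmb q := ((key r hr).trans (key q hq).symm).le
    obtain ⟨t, ht1, ht2⟩ := (mem_regEmb q r).1 ((regEmb_le_iff _ _).1 h1) r le_rfl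
    exact hqr t ht2 ht1
  · intro b
    refine @sigmaDistrib_aux CohenCond _ _ (regularCBA _) regEmb ?_ regEmb_ne_bot ?_
      regEmb_refine CohenCond.closed b
    · intro p q h
      exact Regular.toRegular.monotone (LowerSet.Iic_le.2 h)
    · intro a ha
      obtain ⟨p, hp⟩ := exists_mem_of_ne_bot a ha
      exact ⟨p, (regEmb_le_iff p a).2 hp⟩
end

section
/- Let P be a subfield of ℝ and let f : ℝ → ℝ be a P-linear function, i.e., f is additive and f(p·x) = p·f(x) for all p ∈ P and x ∈ ℝ. Then there exists c ∈ ℝ with f(x) = c·x for all x ∈ ℝ if and only if f is bounded above or bounded below on some interval (a, b) ⊂ ℝ with a < b. -/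
theorem additive_linear_of_bddAbove (f : ℝ → ℝ)
    (hadd : ∀ x y : ℝ, f (x + y) = f x + f y)
    (hq : ∀ (q : ℚ) (x : ℝ), f (q * x) = q * f x) (a b M : ℝ) (hab : a < b)
    (hM : ∀ x ∈ Set.Ioo a b, f x ≤ M) : ∀ x : ℝ, f x = f 1 * x := by
  have key : ∀ x : ℝ, f x - f 1 * x ≤ M + |f 1| * (|a| + |b|) := by
    intro x
    obtain ⟨q, hq1, hq2⟩ := exists_rat_btwn (sub_lt_sub_right hab x)
    have h1 := hM (x + q) ⟨by linarith, by linarith⟩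
    have h2 : f q = q * f 1 := by simpa using hq q 1
    rw [hadd, h2] at h1
    have h3 : |x + q| ≤ |a| + |b| := by
      rw [abs_le]
      constructor
      · linarith [neg_abs_le a, abs_nonneg b]
      · linarith [le_abs_self b, abs_nonneg a]
    have h4 : -(f 1 * (x + q)) ≤ |f 1| * (|a| + |b|) :=
      calc -(f 1 * (x + q)) ≤ |f 1 * (x + q)| := neg_le_abs _
        _ = |f 1| * |x + q| := abs_mul _ _
        _ ≤ _ := mul_le_mul_of_nonneg_left h3 (abs_nonneg _)
    linarith
  have key2 : ∀ x : ℝ, f x - f 1 * x ≤ 0 := by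
    intro x
    by_contra! h
    obtain ⟨n, hn⟩ := exists_nat_gt ((M + |f 1| * (|a| + |b|)) / (f x - f 1 * x))
    rw [div_lt_iff₀ h] at hn
    have h1 := key (n * x)
    have h2 : f (n * x) = n * f x := by simpa using hq n x
    rw [h2] at h1
    linarith
  intro x
  have h1 := key2 x
  have h2 := key2 (-x)
  have h3 : f (-x) = - f x := by simpa using hq (-1) x
  rw [h3] at h2
  linarith

/-- 2.1.6(2): a `P`-linear function `f : ℝ → ℝ` (for a subfield `P ⊆ ℝ`) is of the
form `f x = c * x` iff `f` is bounded above or below on some nondegenerate interval. -/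
theorem plinear_eq_mul_iff_bounded_on_interval
    (P : Subfield ℝ) (f : ℝ → ℝ)
    (hadd : ∀ x y : ℝ, f (x + y) = f x + f y)
    (hsmul : ∀ p ∈ P, ∀ x : ℝ, f (p * x) = p * f x) :
    (∃ c : ℝ, ∀ x : ℝ, f x = c * x) ↔
      ∃ a b : ℝ, a < b ∧
        ((∃ M : ℝ, ∀ x ∈ Set.Ioo a b, f x ≤ M) ∨
         (∃ M : ℝ, ∀ x ∈ Set.Ioo a b, M ≤ f x)) := by
  have hq : ∀ (q : ℚ) (x : ℝ), f (q * x) = q * f x :=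
    fun q x => hsmul q (SubfieldClass.ratCast_mem P q) x
  constructor
  · rintro ⟨c, hc⟩
    refine ⟨0, 1, one_pos, Or.inl ⟨|c|, ?_⟩⟩
    rintro x ⟨h0, h1⟩
    rw [hc]
    nlinarith [le_abs_self c, abs_nonneg c]
  · rintro ⟨a, b, hab, ⟨M, hM⟩ | ⟨M, hM⟩⟩
    · exact ⟨f 1, additive_linear_of_bddAbove f hadd hq a b M hab hM⟩
    · refine ⟨f 1, fun x => ?_⟩
      have := additive_linear_of_bddAbove (fun x => - f x)
        (fun x y => by simp only [hadd]; ring) (fun q x => by simp only [hq]; ring)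
        a b (-M) hab (fun x hx => neg_le_neg (hM x hx)) x
      linarith
end

section
/- Let P be a subfield of ℝ and let f : ℝ → ℝ be a P-linear function. If there is no c ∈ ℝ such that f(x) = c·x for all x ∈ ℝ, then the graph {(x, f(x)) : x ∈ ℝ} of f is dense in ℝ × ℝ. -/
/-- If a `P`-linear function `f : ℝ → ℝ` (for a subfield `P ⊆ ℝ`) is not of the
form `x ↦ c * x`, then its graph is dense in the plane. -/
theorem dense_graph_of_plinear_not_mul
    (P : Subfield ℝ) (f : ℝ → ℝ)
    (hadd : ∀ x y : ℝ, f (x + y) = f x + f y)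
    (hsmul : ∀ p ∈ P, ∀ x : ℝ, f (p * x) = p * f x)
    (h : ¬ ∃ c : ℝ, ∀ x : ℝ, f x = c * x) :
    Dense {p : ℝ × ℝ | p.2 = f p.1} := by
  have hx : ∃ x : ℝ, f x ≠ f 1 * x := by
    by_contra! hc
    exact h ⟨f 1, hc⟩
  obtain ⟨x, hx⟩ := hx
  have hD : f x - f 1 * x ≠ 0 := sub_ne_zero.mpr hx
  let g : ℝ × ℝ → ℝ × ℝ := fun q => (q.1 + q.2 * x, q.1 * f 1 + q.2 * f x)
  have hg : Continuous g := by
    show Continuous (fun q : ℝ × ℝ => (q.1 + q.2 * x, q.1 * f 1 + q.2 * f x))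
    fun_prop
  have hs : Function.Surjective g := by
    rintro ⟨a, b⟩
    refine ⟨(a - (b - f 1 * a) / (f x - f 1 * x) * x, (b - f 1 * a) / (f x - f 1 * x)), ?_⟩
    refine Prod.ext ?_ ?_
    · show a - (b - f 1 * a) / (f x - f 1 * x) * x + (b - f 1 * a) / (f x - f 1 * x) * x = a
      ring
    · show (a - (b - f 1 * a) / (f x - f 1 * x) * x) * f 1
        + (b - f 1 * a) / (f x - f 1 * x) * f x = b
      have := div_mul_cancel₀ (b - f 1 * a) hD
      linear_combination this
  have hQ : DenseRange (Rat.cast : ℚ → ℝ) := Rat.denseRange_cast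
  have hd := hs.denseRange.comp (hQ.prodMap hQ) hg
  refine Dense.mono ?_ hd
  rintro _ ⟨⟨s, t⟩, rfl⟩
  show (s : ℝ) * f 1 + (t : ℝ) * f x = f ((s : ℝ) + (t : ℝ) * x)
  have h1 := hsmul s (SubfieldClass.ratCast_mem P s) 1
  rw [mul_one] at h1
  rw [hadd, h1, hsmul t (SubfieldClass.ratCast_mem P t)]
end

section
/- Let P be a subfield of ℂ such that ℂ is a transcendental extension of P, i.e., ℂ is not algebraic over P. Then there exists a nontrivial P-automorphism of ℂ: a ring automorphism φ : ℂ → ℂ with φ(p) = p for all p ∈ P and φ ≠ id. -/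
/-- Proposition 3.2.4: if `ℂ` is a transcendental extension of a subfield `P`,
then there is a nontrivial `P`-automorphism of `ℂ`. -/
theorem exists_nontrivial_automorphism_fixing_subfield
    (P : Subfield ℂ) (h : ¬ ∀ z : ℂ, IsAlgebraic P z) :
    ∃ φ : ℂ ≃+* ℂ, (∀ p ∈ P, φ p = p) ∧ φ ≠ RingEquiv.refl ℂ := by
  obtain ⟨s, hs⟩ := exists_isTranscendenceBasis P ℂ
  have hne : Nonempty s := by
    by_contra hcon
    rw [not_nonempty_iff] at hcon
    have := (hs.isEmpty_iff_isAlgebraic).1 hcon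
    exact h this.isAlgebraic
  obtain ⟨i⟩ := hne
  have := IsAlgClosed.isAlgClosure_of_transcendence_basis _ hs
  let T : MvPolynomial s P ≃ₐ[P] MvPolynomial s P :=
    AlgEquiv.ofAlgHom (MvPolynomial.aeval (fun j => MvPolynomial.X j + 1))
      (MvPolynomial.aeval (fun j => MvPolynomial.X j - 1))
      (by ext; simp) (by ext; simp)
  let e := (hs.1.aevalEquiv.symm.trans T).trans hs.1.aevalEquiv
  let φ : ℂ ≃+* ℂ := IsAlgClosure.equivOfEquiv ℂ ℂ e.toRingEquiv
  have hφ : ∀ a, φ (algebraMap _ ℂ a) = algebraMap _ ℂ (e a) := fun a =>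
    IsAlgClosure.equivOfEquiv_algebraMap ℂ ℂ e.toRingEquiv a
  refine ⟨φ, fun p hp => ?_, fun hid => ?_⟩
  · have := hφ (algebraMap P _ ⟨p, hp⟩)
    rw [e.commutes] at this
    exact this
  · have h1 := hφ (hs.1.aevalEquiv (MvPolynomial.X i))
    have h2 : e (hs.1.aevalEquiv (MvPolynomial.X i))
        = hs.1.aevalEquiv (MvPolynomial.X i) + 1 := by
      simp [e, T]
    rw [h2, hid, map_add, map_one] at h1
    simp at h1
end

section
/- Let P be a subfield of ℂ such that ℂ is a transcendental extension of P, i.e., ℂ is not algebraic over P. Then there exists a nontrivial P-derivation on ℂ: a P-linear map D : ℂ → ℂ with D(xy) = D(x)·y + x·D(y) for all x, y ∈ ℂ and D ≠ 0. -/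
open scoped IntermediateField.algebraAdjoinAdjoin in
theorem formallyEtale_adjoin_of_isTranscendenceBasis {K L ι : Type*} [Field K] [Field L]
    [Algebra K L] [CharZero K] {v : ι → L} (hv : IsTranscendenceBasis K v) :
    Algebra.FormallyEtale (Algebra.adjoin K (Set.range v)) L := by
  have h1 : Algebra.FormallyEtale (Algebra.adjoin K (Set.range v))
      (IntermediateField.adjoin K (Set.range v)) :=
    .of_isLocalization (nonZeroDivisors _)
  have h2 := hv.isAlgebraic_field
  have h0 : CharZero (IntermediateField.adjoin K (Set.range v)) :=
    charZero_of_injective_algebraMap (algebraMap K _).injective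
  have h3 : Algebra.FormallyEtale (IntermediateField.adjoin K (Set.range v)) L :=
    Algebra.FormallyEtale.of_isSeparable _ L
  exact .comp _ (IntermediateField.adjoin K (Set.range v)) _

/-- Proposition 3.2.5: if `ℂ` is a transcendental extension of a subfield `P`,
then there is a nontrivial `P`-derivation on `ℂ`. -/
theorem exists_nontrivial_derivation_complex
    (P : Subfield ℂ) (h : ¬ ∀ z : ℂ, IsAlgebraic P z) :
    ∃ D : ℂ → ℂ,
      (∀ x y : ℂ, D (x + y) = D x + D y) ∧
      (∀ p ∈ P, ∀ x : ℂ, D (p * x) = p * D x) ∧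
      (∀ x y : ℂ, D (x * y) = D x * y + x * D y) ∧
      D ≠ 0 := by
  obtain ⟨ι, v, hv⟩ := exists_isTranscendenceBasis' P ℂ
  have hne : Nonempty ι := by
    rw [hv.nonempty_iff_transcendental, Algebra.transcendental_iff_not_isAlgebraic]
    exact fun H => h H.isAlgebraic
  obtain ⟨i⟩ := hne
  have het := formallyEtale_adjoin_of_isTranscendenceBasis hv
  let A := Algebra.adjoin P (Set.range v)
  let e : MvPolynomial ι P ≃ₐ[P] A := hv.1.aevalEquiv
  let d : Derivation P A ℂ := Derivation.mk'
    (A.val.toLinearMap ∘ₗ e.toLinearMap ∘ₗ (MvPolynomial.pderiv i).toLinearMap ∘ₗ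
      e.symm.toLinearMap) (by
        intro a b
        simp [Algebra.smul_def])
  let f := (d.liftKaehlerDifferential.liftBaseChange ℂ) ∘ₗ
    (KaehlerDifferential.tensorKaehlerEquivOfFormallyEtale P A ℂ).symm.toLinearMap
  let D : Derivation P ℂ ℂ := f.compDer (KaehlerDifferential.D P ℂ)
  refine ⟨D, D.map_add, fun p hp x => D.map_smul ⟨p, hp⟩ x, fun x y => ?_, fun h0 => ?_⟩
  · rw [D.leibniz]; simp only [smul_eq_mul]; ring
  · have h1 : D (algebraMap A ℂ (e (MvPolynomial.X i))) = 1 := by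
      change f (KaehlerDifferential.D P ℂ _) = 1
      simp only [f, LinearMap.comp_apply, LinearEquiv.coe_coe]
      rw [KaehlerDifferential.tensorKaehlerEquivOfFormallyEtale_symm_D_algebraMap]
      simp [d]
    rw [h0] at h1
    simp at h1
end

section
/- Let P be a subfield of ℝ such that ℝ is a transcendental extension of P, i.e., ℝ is not algebraic over P. Then there exists a nontrivial P-derivation on ℝ: a P-linear map D : ℝ → ℝ with D(xy) = D(x)·y + x·D(y) for all x, y ∈ ℝ and D ≠ 0. -/
/-- A field of characteristic zero which is algebraic over a subdomain is formally etale over it. -/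
theorem formallyEtale_aux (R L : Type) [CommRing R] [IsDomain R] [Field L] [CharZero L]
    [Algebra R L] [FaithfulSMul R L] [Algebra.IsAlgebraic R L] : Algebra.FormallyEtale R L := by
  let := FractionRing.liftAlgebra R L
  have := FractionRing.isScalarTower_liftAlgebra R L
  have : Algebra.IsAlgebraic (FractionRing R) L :=
    (IsFractionRing.comap_isAlgebraic_iff (A := R)).mp inferInstance
  have : CharZero (FractionRing R) :=
    (algebraMap (FractionRing R) L).charZero_iff (algebraMap (FractionRing R) L).injective |>.2
      inferInstance
  have : Algebra.FormallyEtale R (FractionRing R) :=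
    .of_isLocalization (nonZeroDivisors R)
  have : Algebra.FormallyEtale (FractionRing R) L := .of_isSeparable _ _
  exact .comp R (FractionRing R) L

open TensorProduct in
/-- Derivations into a formally etale algebra extend. -/
theorem extend_aux (k R L : Type) [CommRing k] [CommRing R] [CommRing L] [Algebra k R]
    [Algebra k L] [Algebra R L] [IsScalarTower k R L] [Algebra.FormallyEtale R L]
    (d : Derivation k R L) :
    ∃ D : Derivation k L L, ∀ r, D (algebraMap R L r) = d r := by
  let f : L ⊗[R] Ω[R⁄k] →ₗ[L] L := LinearMap.liftBaseChange L d.liftKaehlerDifferential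
  let g := f ∘ₗ (KaehlerDifferential.tensorKaehlerEquivOfFormallyEtale k R L).symm.toLinearMap
  refine ⟨g.compDer (KaehlerDifferential.D k L), fun r => ?_⟩
  change f ((KaehlerDifferential.tensorKaehlerEquivOfFormallyEtale k R L).symm
    (KaehlerDifferential.D k L (algebraMap R L r))) = _
  rw [KaehlerDifferential.tensorKaehlerEquivOfFormallyEtale_symm_D_algebraMap]
  simp [f]

/-- 3.2.6(3): if `ℝ` is a transcendental extension of a subfield `P`,
then there is a nontrivial `P`-derivation on `ℝ`. -/
theorem exists_nontrivial_derivation_real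
    (P : Subfield ℝ) (h : ¬ ∀ z : ℝ, IsAlgebraic P z) :
    ∃ D : ℝ → ℝ,
      (∀ x y : ℝ, D (x + y) = D x + D y) ∧
      (∀ p ∈ P, ∀ x : ℝ, D (p * x) = p * D x) ∧
      (∀ x y : ℝ, D (x * y) = D x * y + x * D y) ∧
      D ≠ 0 := by
  obtain ⟨ι, x, hx⟩ := exists_isTranscendenceBasis' P ℝ
  have : Algebra.Transcendental P ℝ := by
    rw [Algebra.transcendental_def]
    simpa [Transcendental] using h
  obtain ⟨i⟩ : Nonempty ι := hx.nonempty_iff_transcendental.2 inferInstance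
  let : Algebra (MvPolynomial ι P) ℝ := (MvPolynomial.aeval x).toAlgebra
  have hmap : ∀ q : MvPolynomial ι P, algebraMap (MvPolynomial ι P) ℝ q =
      MvPolynomial.aeval x q := fun _ => rfl
  have : IsScalarTower P (MvPolynomial ι P) ℝ :=
    .of_algebraMap_eq fun p => by rw [hmap]; simp
  have : FaithfulSMul (MvPolynomial ι P) ℝ :=
    (faithfulSMul_iff_algebraMap_injective _ _).2 hx.1
  have : Algebra.IsAlgebraic (MvPolynomial ι P) ℝ := by
    have := hx.isAlgebraic
    refine Algebra.IsAlgebraic.of_ringHom_of_comp_eq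
      (S := Algebra.adjoin P (Set.range x)) (B := ℝ) hx.1.aevalEquiv (RingHom.id ℝ)
      hx.1.aevalEquiv.surjective Function.injective_id ?_
    refine RingHom.ext fun q => ?_
    exact hx.1.algebraMap_aevalEquiv q
  have := formallyEtale_aux (MvPolynomial ι P) ℝ
  obtain ⟨D, hD⟩ := extend_aux P (MvPolynomial ι P) ℝ (MvPolynomial.mkDerivation P fun _ => 1)
  refine ⟨D, map_add D, fun p hp y => D.map_smul ⟨p, hp⟩ y, fun y z => ?_, fun h0 => ?_⟩
  · rw [D.leibniz, smul_eq_mul, smul_eq_mul]; ring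
  · have := hD (MvPolynomial.X i)
    rw [MvPolynomial.mkDerivation_X, h0] at this
    simp at this
end

section
/- Let P be a subfield of ℂ that is algebraically closed (as a field). The following are equivalent: (1) P = ℂ; (2) every P-linear function f : ℂ → ℂ is order bounded, i.e., maps bounded subsets of ℂ to bounded subsets; (3) there is no nontrivial P-derivation on ℂ, i.e., every P-linear map D : ℂ → ℂ with D(xy) = D(x)y + xD(y) is zero; (4) every P-linear multiplicative map f : ℂ → ℂ (with f(xy) = f(x)f(y) for all x, y) is either the zero map or the identity; (5) every bijective P-linear multiplicative map f : ℂ → ℂ is the identity. -/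
/-- A function `f : ℂ → ℂ` is `P`-linear for a subfield `P ⊆ ℂ`. -/
def PLinearMap (P : Subfield ℂ) (f : ℂ → ℂ) : Prop :=
  (∀ x y : ℂ, f (x + y) = f x + f y) ∧ ∀ p ∈ P, ∀ x : ℂ, f (p * x) = p * f x

open scoped TensorProduct

lemma aux_basis (P : Subfield ℂ) (hP : IsAlgClosed P) (hne : P ≠ ⊤) :
    ∃ (ι : Type) (x : ι → ℂ), Nonempty ι ∧ IsTranscendenceBasis P x := by
  obtain ⟨ι, x, hx⟩ := exists_isTranscendenceBasis' P ℂ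
  refine ⟨ι, x, ?_, hx⟩
  by_contra h
  rw [not_nonempty_iff] at h
  have : Algebra.IsAlgebraic P ℂ := hx.isEmpty_iff_isAlgebraic.mp h
  have hs := (IsAlgClosed.algebraMap_bijective_of_isIntegral (k := P) (K := ℂ)).2
  apply hne
  rw [eq_top_iff]
  intro z _
  obtain ⟨p, rfl⟩ := hs z
  exact p.2

lemma aux_auto (P : Subfield ℂ) (hP : IsAlgClosed P) (hne : P ≠ ⊤) :
    ∃ f : ℂ ≃+* ℂ, (∀ p ∈ P, f p = p) ∧ ∃ z, f z ≠ z := by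
  obtain ⟨ι, x, ⟨i⟩, hx⟩ := aux_basis P hP hne
  let _ : Algebra (MvPolynomial ι P) ℂ := (MvPolynomial.aeval x).toRingHom.toAlgebra
  have hmap : ∀ q, algebraMap (MvPolynomial ι P) ℂ q = MvPolynomial.aeval x q := fun _ => rfl
  have : IsScalarTower P (MvPolynomial ι P) ℂ := IsScalarTower.of_algebraMap_eq (by
    intro p; rw [hmap]; simp)
  have : FaithfulSMul (MvPolynomial ι P) ℂ := (faithfulSMul_iff_algebraMap_injective _ _).2 hx.1
  have halg : Algebra.IsAlgebraic (MvPolynomial ι P) ℂ := by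
    have := hx.isAlgebraic
    exact Algebra.IsAlgebraic.of_ringHom_of_comp_eq (R := MvPolynomial ι P)
      (S := Algebra.adjoin P (Set.range x)) (A := ℂ) (B := ℂ) hx.1.aevalEquiv.toRingHom
      (RingHom.id ℂ) hx.1.aevalEquiv.surjective Function.injective_id (by ext <;> simp [hmap])
  have : IsAlgClosure (MvPolynomial ι P) ℂ := ⟨inferInstance, halg⟩
  let s : MvPolynomial ι P →ₐ[P] MvPolynomial ι P := MvPolynomial.aeval (fun j => - MvPolynomial.X j)
  have hs : s.comp s = AlgHom.id _ _ := by ext j; simp [s]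
  let e : MvPolynomial ι P ≃ₐ[P] MvPolynomial ι P := AlgEquiv.ofAlgHom s s hs hs
  let f := IsAlgClosure.equivOfEquiv ℂ ℂ e.toRingEquiv
  have hf : ∀ q, f (algebraMap (MvPolynomial ι P) ℂ q) = algebraMap _ ℂ (e q) := fun q =>
    IsAlgClosure.equivOfEquiv_algebraMap ℂ ℂ e.toRingEquiv q
  refine ⟨f, ?_, x i, ?_⟩
  · intro p hp
    have := hf (MvPolynomial.C ⟨p, hp⟩)
    have h2 : f (algebraMap P ℂ ⟨p, hp⟩) = algebraMap P ℂ ⟨p, hp⟩ := by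
      simpa [hmap, e, s, MvPolynomial.algebraMap_eq] using this
    exact h2
  · have := hf (MvPolynomial.X i)
    have h2 : f (x i) = - x i := by simpa [hmap, e, s] using this
    rw [h2]
    have h0 : x i ≠ 0 := hx.1.ne_zero i
    intro h
    exact h0 (by linear_combination (-1/2 : ℂ) * h)

lemma aux_der (P : Subfield ℂ) (hP : IsAlgClosed P) (hne : P ≠ ⊤) :
    ∃ d : Derivation P ℂ ℂ, d ≠ 0 := by
  obtain ⟨ι, x, ⟨i⟩, hx⟩ := aux_basis P hP hne
  let A := MvPolynomial ι P
  let _ : Algebra A ℂ := (MvPolynomial.aeval x).toRingHom.toAlgebra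
  have hmap : ∀ q, algebraMap A ℂ q = MvPolynomial.aeval x q := fun _ => rfl
  have : IsScalarTower P A ℂ := IsScalarTower.of_algebraMap_eq (by
    intro p; rw [hmap]; simp [A])
  have : FaithfulSMul A ℂ := (faithfulSMul_iff_algebraMap_injective _ _).2 hx.1
  have halg : Algebra.IsAlgebraic A ℂ := by
    have := hx.isAlgebraic
    exact Algebra.IsAlgebraic.of_ringHom_of_comp_eq (R := A)
      (S := Algebra.adjoin P (Set.range x)) (A := ℂ) (B := ℂ) hx.1.aevalEquiv.toRingHom
      (RingHom.id ℂ) hx.1.aevalEquiv.surjective Function.injective_id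
      (by apply MvPolynomial.ringHom_ext <;> simp [hmap])
  let _ : Algebra (FractionRing A) ℂ := FractionRing.liftAlgebra A ℂ
  have : IsScalarTower A (FractionRing A) ℂ := inferInstance
  have : Algebra.IsAlgebraic (FractionRing A) ℂ :=
    (IsFractionRing.comap_isAlgebraic_iff (A := A) (K := FractionRing A) (C := ℂ)).1 halg
  have : CharZero A := inferInstanceAs (CharZero (MvPolynomial ι P))
  have : CharZero (FractionRing A) := inferInstance
  have : Algebra.FormallyEtale (FractionRing A) ℂ := Algebra.FormallyEtale.of_isSeparable _ _
  have : Algebra.FormallyEtale A (FractionRing A) :=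
    Algebra.FormallyEtale.of_isLocalization (nonZeroDivisors A)
  have : Algebra.FormallyEtale A ℂ := Algebra.FormallyEtale.comp A (FractionRing A) ℂ
  let l : Ω[A⁄P] →ₗ[A] ℂ := (Algebra.linearMap A ℂ).comp (MvPolynomial.pderiv i).liftKaehlerDifferential
  let L : ℂ ⊗[A] Ω[A⁄P] →ₗ[ℂ] ℂ := LinearMap.liftBaseChange ℂ l
  let d : Derivation P ℂ ℂ := (L.comp
    (KaehlerDifferential.tensorKaehlerEquivOfFormallyEtale P A ℂ).symm.toLinearMap).compDer
      (KaehlerDifferential.D P ℂ)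
  refine ⟨d, fun h => ?_⟩
  have h1 : d (algebraMap A ℂ (MvPolynomial.X i)) = 1 := by
    change L ((KaehlerDifferential.tensorKaehlerEquivOfFormallyEtale P A ℂ).symm
      (KaehlerDifferential.D P ℂ (algebraMap A ℂ (MvPolynomial.X i)))) = 1
    rw [KaehlerDifferential.tensorKaehlerEquivOfFormallyEtale_symm_D_algebraMap]
    have h2 : (MvPolynomial.pderiv i).liftKaehlerDifferential
        ((KaehlerDifferential.D P A) (MvPolynomial.X i)) = (1 : A) := by
      rw [Derivation.liftKaehlerDifferential_comp_D]
      exact MvPolynomial.pderiv_X_self i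
    simp [L, l, h2]
  rw [h] at h1
  simp at h1

lemma aux_dense (P : Subfield ℂ) (hP : IsAlgClosed P) (z : ℂ) (ε : ℝ) (hε : 0 < ε) :
    ∃ p ∈ P, ‖z - p‖ < ε := by
  have hI : Complex.I ∈ P := by
    obtain ⟨j, hj⟩ := IsAlgClosed.exists_pow_nat_eq (-1 : P) (n := 2) (by norm_num)
    have hj' : (j : ℂ) ^ 2 = -1 := by exact_mod_cast congrArg Subtype.val hj
    have : ((j : ℂ) - Complex.I) * (j + Complex.I) = 0 := by
      ring_nf; rw [hj']; simp
    rcases mul_eq_zero.1 this with h | h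
    · rw [← sub_eq_zero.1 h]; exact j.2
    · have : Complex.I = - (j : ℂ) := by linear_combination h
      rw [this]; exact neg_mem j.2
  obtain ⟨a, ha⟩ := Rat.denseRange_cast.exists_dist_lt z.re (half_pos hε)
  obtain ⟨b, hb⟩ := Rat.denseRange_cast.exists_dist_lt z.im (half_pos hε)
  refine ⟨(a : ℂ) + b * Complex.I, add_mem (SubfieldClass.ratCast_mem P a)
    (mul_mem (SubfieldClass.ratCast_mem P b) hI), ?_⟩
  refine (Complex.norm_le_abs_re_add_abs_im _).trans_lt ?_
  rw [Real.dist_eq] at ha hb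
  simp
  linarith

lemma aux_unbdd (P : Subfield ℂ) (hP : IsAlgClosed P)
    (h : ∀ f : ℂ → ℂ, PLinearMap P f →
         ∀ S : Set ℂ, Bornology.IsBounded S → Bornology.IsBounded (f '' S)) : P = ⊤ := by
  rw [eq_top_iff]
  intro z _
  by_contra hz
  let W : Submodule P ℂ := 1
  have hW : z ∉ W := by
    intro hh
    obtain ⟨p, hp⟩ := Submodule.mem_one.1 hh
    exact hz (hp ▸ p.2)
  obtain ⟨f, hf1, hf2⟩ := Submodule.exists_le_ker_of_notMem hW
  have hfP : ∀ p ∈ P, f p = 0 := fun p hp =>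
    hf2 (Submodule.mem_one.2 ⟨⟨p, hp⟩, rfl⟩)
  have hlin : PLinearMap P (fun w => (f w : ℂ)) := by
    refine ⟨fun x y => by simp, fun p hp w => ?_⟩
    have := f.map_smul ⟨p, hp⟩ w
    have h2 := congrArg (Subtype.val) this
    exact h2
  have hb := h _ hlin (Metric.ball 0 1) Metric.isBounded_ball
  obtain ⟨C, hC⟩ := hb.exists_norm_le
  have hf1' : 0 < ‖(f z : ℂ)‖ := by simpa using hf1
  obtain ⟨n, hn⟩ := exists_nat_gt (C / ‖(f z : ℂ)‖)
  obtain ⟨p, hp, hzp⟩ := aux_dense P hP z (1 / (n + 1)) (by positivity)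
  have hv : (f ((n + 1 : ℂ) * (z - p)) : ℂ) = (n + 1) * f z := by
    have := hlin.2 (n + 1) (add_mem (natCast_mem P n) (one_mem P)) (z - p)
    simp only at this
    rw [this, map_sub, hfP p hp, sub_zero]
  have hno : ‖(n + 1 : ℂ)‖ = n + 1 := by exact_mod_cast Complex.norm_natCast (n + 1)
  have := hC _ ⟨(n + 1 : ℂ) * (z - p), by
    rw [mem_ball_zero_iff, norm_mul, hno]
    rwa [lt_div_iff₀' (by positivity)] at hzp, rfl⟩
  simp only at this
  rw [hv, norm_mul, hno] at this
  rw [div_lt_iff₀ hf1'] at hn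
  linarith

/-- Theorem 3.2.7: characterizations of an algebraically closed subfield `P ⊆ ℂ`
coinciding with `ℂ`, in terms of `P`-linear functions, derivations,
endomorphisms, and automorphisms. -/
theorem algClosed_subfield_eq_top_tfae (P : Subfield ℂ) (hP : IsAlgClosed P) :
    List.TFAE
      [P = ⊤,
       ∀ f : ℂ → ℂ, PLinearMap P f →
         ∀ S : Set ℂ, Bornology.IsBounded S → Bornology.IsBounded (f '' S),
       ∀ D : ℂ → ℂ, PLinearMap P D →
         (∀ x y : ℂ, D (x * y) = D x * y + x * D y) → D = 0,
       ∀ f : ℂ → ℂ, PLinearMap P f →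
         (∀ x y : ℂ, f (x * y) = f x * f y) → f = 0 ∨ f = id,
       ∀ f : ℂ → ℂ, PLinearMap P f →
         (∀ x y : ℂ, f (x * y) = f x * f y) → Function.Bijective f → f = id] := by
  have key : P = ⊤ → ∀ f : ℂ → ℂ, PLinearMap P f → ∀ x, f x = x * f 1 := by
    intro h f hf x
    have := hf.2 x (by rw [h]; trivial) 1
    rwa [mul_one] at this
  tfae_have 1 → 2 := by
    intro h f hf S hS
    obtain ⟨C, hC⟩ := hS.exists_norm_le
    refine isBounded_iff_forall_norm_le.2 ⟨C * ‖f 1‖, ?_⟩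
    rintro _ ⟨x, hx, rfl⟩
    rw [key h f hf x, norm_mul]
    exact mul_le_mul_of_nonneg_right (hC x hx) (norm_nonneg _)
  tfae_have 2 → 1 := aux_unbdd P hP
  tfae_have 1 → 3 := by
    intro h D hD hl
    have h1 := hl 1 1
    have h0 : D 1 = 0 := by simpa using h1
    funext x
    simp [key h D hD x, h0]
  tfae_have 3 → 1 := by
    intro h
    by_contra hne
    obtain ⟨d, hd⟩ := aux_der P hP hne
    apply hd
    have := h d ⟨fun x y => map_add d x y, fun p hp x => by
      exact d.map_smul (⟨p, hp⟩ : P) x⟩ (fun x y => by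
        rw [d.leibniz]; simp only [smul_eq_mul]; ring)
    ext x
    exact congrFun this x
  tfae_have 1 → 4 := by
    intro h f hf hm
    have h1 := hm 1 1
    rw [mul_one] at h1
    have h2 : f 1 = 0 ∨ f 1 = 1 := by
      by_cases h0 : f 1 = 0
      · exact Or.inl h0
      · exact Or.inr (mul_left_cancel₀ h0 (by rw [← h1, mul_one]))
    refine h2.imp (fun h0 => ?_) (fun h0 => ?_)
    · funext x; simp [key h f hf x, h0]
    · funext x; simp [key h f hf x, h0]
  tfae_have 4 → 5 := by
    intro h f hf hm hb
    refine (h f hf hm).resolve_left ?_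
    rintro rfl
    exact zero_ne_one (hb.1 (a₁ := (0 : ℂ)) (a₂ := 1) rfl)
  tfae_have 5 → 1 := by
    intro h
    by_contra hne
    obtain ⟨f, hf, z, hz⟩ := aux_auto P hP hne
    apply hz
    exact congrFun (h f ⟨fun x y => map_add f x y, fun p hp x => by rw [map_mul, hf p hp]⟩
      (fun x y => map_mul f x y) f.bijective) z
  tfae_finish
end

section
/- Every universally complete vector lattice G possesses a local Hamel basis, i.e., a locally linearly independent subset of G that is maximal with respect to inclusion among locally linearly independent subsets. -/
universe u

/-- The lattice, additive, and scalar structures on `G` are compatible: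
`G` is a (real) vector lattice. -/
def IsVectorLattice (G : Type u) [Lattice G] [AddCommGroup G] [Module ℝ G] : Prop :=
  (∀ x y z : G, x ≤ y → x + z ≤ y + z) ∧
  ∀ (c : ℝ) (x : G), 0 ≤ c → 0 ≤ x → 0 ≤ c • x

/-- Every nonempty subset bounded above has a least upper bound. -/
def DedekindComplete (G : Type u) [Lattice G] : Prop :=
  ∀ S : Set G, S.Nonempty → BddAbove S → ∃ b : G, IsLUB S b

/-- `G` is universally complete: Dedekind complete and every set of pairwise
disjoint positive elements is bounded above. -/
def UniversallyComplete (G : Type u) [Lattice G] [AddCommGroup G] : Prop :=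
  DedekindComplete G ∧
    ∀ S : Set G, (∀ x ∈ S, 0 ≤ x) → (S.Pairwise fun x y => x ⊓ y = 0) → BddAbove S

/-- A band projection: a linear idempotent `π` with `0 ≤ π x ≤ x` for `x ≥ 0`. -/
def IsBandProjection {G : Type u} [Lattice G] [AddCommGroup G] [Module ℝ G]
    (π : G →ₗ[ℝ] G) : Prop :=
  (∀ x : G, π (π x) = π x) ∧ ∀ x : G, 0 ≤ x → 0 ≤ π x ∧ π x ≤ x

/-- A set `E ⊆ G` is locally linearly independent: whenever `e₁, …, eₙ ∈ E`,
`λ₁, …, λₙ ∈ ℝ`, and `π` is a band projection with `π (λ₁ e₁ + ⋯ + λₙ eₙ) = 0`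
and `π e₁, …, π eₙ` nonzero and pairwise distinct, all `λᵢ` vanish. -/
def LocallyLinearlyIndependent {G : Type u} [Lattice G] [AddCommGroup G] [Module ℝ G]
    (E : Set G) : Prop :=
  ∀ (n : ℕ) (e : Fin n → G) (lam : Fin n → ℝ) (π : G →ₗ[ℝ] G),
    IsBandProjection π → (∀ i, e i ∈ E) →
    (∀ i, π (e i) ≠ 0) → Function.Injective (fun i => π (e i)) →
    π (∑ i, lam i • e i) = 0 → ∀ i, lam i = 0

/-- A local Hamel basis: an inclusion-maximal locally linearly independent set. -/
def IsLocalHamelBasis {G : Type u} [Lattice G] [AddCommGroup G] [Module ℝ G]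
    (E : Set G) : Prop :=
  LocallyLinearlyIndependent E ∧
    ∀ F : Set G, LocallyLinearlyIndependent F → E ⊆ F → F = E

/-- Proposition 1.2.1: every universally complete vector lattice possesses
a local Hamel basis. -/
theorem exists_localHamelBasis
    {G : Type u} [Lattice G] [AddCommGroup G] [Module ℝ G]
    (hVL : IsVectorLattice G) (hUC : UniversallyComplete G) :
    ∃ E : Set G, IsLocalHamelBasis E := by
  obtain ⟨E, hE⟩ := zorn_subset {E : Set G | LocallyLinearlyIndependent E} (by
    intro c hc hchain
    refine ⟨⋃₀ c, ?_, fun s hs => Set.subset_sUnion_of_mem hs⟩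
    intro n e lam π hπ he hne hinj hsum i
    obtain ⟨s₀, hs₀, -⟩ := he i
    obtain ⟨t, ht, hsub⟩ := DirectedOn.exists_mem_subset_of_finite_of_subset_sUnion
      ⟨s₀, hs₀⟩ hchain.directedOn (Set.finite_range e)
      (Set.range_subset_iff.2 he)
    exact hc ht n e lam π hπ (fun j => hsub (Set.mem_range_self j)) hne hinj hsum i)
  exact ⟨E, hE.prop, fun F hF hEF => (hE.eq_of_subset hF hEF).symm⟩
end

section
/- Let G be a universally complete vector lattice with weak order unit 𝟙. Then G is locally one-dimensional (every x ∈ G with x ≥ 0 equals sup {λ_ξ • π_ξ 𝟙 : ξ ∈ Ξ} for some family of reals (λ_ξ) and some family (π_ξ) of pairwise disjoint band projections) if and only if every band preserving linear operator T : G → G is order bounded. -/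
universe u



/-- A weak order unit of `G`. -/
def IsWeakOrderUnit {G : Type u} [Lattice G] [AddCommGroup G] (e : G) : Prop :=
  0 < e ∧ ∀ x : G, 0 ≤ x → x ⊓ e = 0 → x = 0

/-- `x` is locally constant with respect to `f`: `x` is the supremum of a family
`λ_ξ • π_ξ f` for reals `λ_ξ` and pairwise disjoint band projections `π_ξ`. -/
def LocallyConstantWrt {G : Type u} [Lattice G] [AddCommGroup G] [Module ℝ G]
    (x f : G) : Prop :=
  ∃ (ι : Type u) (lam : ι → ℝ) (π : ι → G →ₗ[ℝ] G),
    (∀ ξ, IsBandProjection (π ξ)) ∧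
    (Pairwise fun ξ η => ∀ y : G, (π ξ) ((π η) y) = 0) ∧
    IsLUB (Set.range fun ξ => lam ξ • (π ξ) f) x

section WicksteadHelpers

variable {G : Type u} [Lattice G] [AddCommGroup G] [Module ℝ G]

theorem wp_abs_zero [IsOrderedAddMonoid G] {a : G} (h : |a| = 0) : a = 0 := by
  apply le_antisymm
  · exact h ▸ le_abs_self a
  · have := neg_le_abs a
    rw [h] at this
    simpa using this

theorem wp_inf_add_le [IsOrderedAddMonoid G] {a b v : G} (ha : 0 ≤ a) (hb : 0 ≤ b) (hv : 0 ≤ v) :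
    (a + b) ⊓ v ≤ a ⊓ v + b ⊓ v := by
  rw [inf_add, add_inf, add_inf]
  refine le_inf (le_inf inf_le_left ?_) (le_inf ?_ ?_)
  · exact inf_le_right.trans (le_add_of_nonneg_left ha)
  · exact inf_le_right.trans (le_add_of_nonneg_right hb)
  · exact inf_le_right.trans (le_add_of_nonneg_left hv)

theorem wp_abs_smul_le [IsOrderedAddMonoid G] [PosSMulMono ℝ G] (c : ℝ) (z : G) :
    |c • z| ≤ |c| • |z| := by
  have key : ∀ z : G, c • z ≤ |c| • |z| := by
    intro z
    rcases le_total 0 c with h | h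
    · rw [abs_of_nonneg h]
      exact smul_le_smul_of_nonneg_left (le_abs_self z) h
    · rw [abs_of_nonpos h]
      have := smul_le_smul_of_nonneg_left (neg_le_abs z) (neg_nonneg.2 h)
      simpa using this
  refine abs_le'.2 ⟨key z, ?_⟩
  have := key (-z)
  simpa using this

theorem wp_smul_mono [IsOrderedAddMonoid G] [PosSMulMono ℝ G] {a b : ℝ} (h : a ≤ b) {x : G}
    (hx : 0 ≤ x) : a • x ≤ b • x := by
  have := smul_nonneg (sub_nonneg.2 h) hx
  rw [sub_smul] at this
  exact sub_nonneg.1 this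

/-- disjoint complement -/
def wpDisj [IsOrderedAddMonoid G] [PosSMulMono ℝ G] (S : Set G) : Submodule ℝ G where
  carrier := {z | ∀ s ∈ S, |z| ⊓ |s| = 0}
  zero_mem' := by
    intro s _
    simp
  add_mem' := by
    intro a b ha hb s hs
    apply le_antisymm
    · have h1 := wp_inf_add_le (abs_nonneg a) (abs_nonneg b) (abs_nonneg s)
      rw [ha s hs, hb s hs, add_zero] at h1
      exact (inf_le_inf_right _ (abs_add_le a b)).trans h1
    · exact le_inf (abs_nonneg _) (abs_nonneg _)
  smul_mem' := by
    intro c z hz s hs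
    have hn : ∀ n : ℕ, ((n : ℝ) • |z|) ⊓ |s| ≤ 0 := by
      intro n
      induction n with
      | zero => simp
      | succ k ih =>
        have h1 := wp_inf_add_le (a := (k : ℝ) • |z|) (smul_nonneg (Nat.cast_nonneg k) (abs_nonneg z))
          (abs_nonneg z) (abs_nonneg s)
        rw [hz s hs, add_zero] at h1
        push_cast
        rw [add_smul, one_smul]
        exact h1.trans ih
    obtain ⟨n, hn'⟩ := exists_nat_ge |c|
    apply le_antisymm
    · refine le_trans (inf_le_inf_right _ ?_) (hn n)
      exact (wp_abs_smul_le c z).trans (wp_smul_mono hn' (abs_nonneg z))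
    · exact le_inf (abs_nonneg _) (abs_nonneg _)

theorem wp_mem_disj [IsOrderedAddMonoid G] [PosSMulMono ℝ G] {S : Set G} {z : G} :
    z ∈ wpDisj S ↔ ∀ s ∈ S, |z| ⊓ |s| = 0 := Iff.rfl

theorem wp_disj_solid [IsOrderedAddMonoid G] [PosSMulMono ℝ G] {S : Set G} {z w : G}
    (hz : z ∈ wpDisj S) (hw : |w| ≤ |z|) : w ∈ wpDisj S := by
  intro s hs
  apply le_antisymm
  · exact (inf_le_inf_right _ hw).trans (hz s hs).le
  · exact le_inf (abs_nonneg _) (abs_nonneg _)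

/-- Decomposition of positive elements. -/
theorem wp_decomp [IsOrderedAddMonoid G] [PosSMulMono ℝ G] (hD : DedekindComplete G)
    (v : G) {x : G} (hx : 0 ≤ x) :
    ∃ x1, 0 ≤ x1 ∧ x1 ≤ x ∧ x1 ∈ wpDisj (wpDisj {v} : Set G) ∧ x - x1 ∈ wpDisj ({v} : Set G) := by
  set B : Submodule ℝ G := wpDisj ({v} : Set G) with hB
  set C : Submodule ℝ G := wpDisj (B : Set G) with hC
  have hvC : |v| ∈ C := by
    intro s hs
    have := hs v rfl
    rw [abs_abs, inf_comm]; exact this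
  obtain ⟨x1, h1⟩ := hD {z | 0 ≤ z ∧ z ≤ x ∧ z ∈ C} ⟨0, le_rfl, hx, C.zero_mem⟩
    ⟨x, fun z hz => hz.2.1⟩
  have hx1 : 0 ≤ x1 := h1.1 ⟨le_rfl, hx, C.zero_mem⟩
  have hx1x : x1 ≤ x := h1.2 fun z hz => hz.2.1
  have hx1C : x1 ∈ C := by
    intro b hb
    rw [abs_of_nonneg hx1]
    have hw0 : 0 ≤ x1 ⊓ |b| := le_inf hx1 (abs_nonneg _)
    apply le_antisymm _ hw0
    have : x1 ≤ x1 - x1 ⊓ |b| := by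
      apply h1.2
      intro z hz
      have hzd : z ⊓ (x1 ⊓ |b|) = 0 := by
        apply le_antisymm
        · have := hz.2.2 b hb
          rw [abs_of_nonneg hz.1] at this
          rw [← this]
          exact inf_le_inf_left _ inf_le_right
        · exact le_inf hz.1 hw0
      have h2 := inf_add_sup z (x1 ⊓ |b|)
      rw [hzd, zero_add] at h2
      rw [le_sub_iff_add_le, ← h2]
      exact sup_le (h1.1 hz) inf_le_left
    have h3 := sub_nonneg.2 this
    simpa using h3
  refine ⟨x1, hx1, hx1x, hx1C, ?_⟩
  rintro s rfl
  rw [abs_of_nonneg (sub_nonneg.2 hx1x)]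
  have hw0 : 0 ≤ (x - x1) ⊓ |s| := le_inf (sub_nonneg.2 hx1x) (abs_nonneg _)
  apply le_antisymm _ hw0
  have hwC : (x - x1) ⊓ |s| ∈ C := by
    apply wp_disj_solid hvC
    rw [abs_of_nonneg hw0, abs_abs]
    exact inf_le_right
  have : x1 + (x - x1) ⊓ |s| ≤ x1 := by
    apply h1.1
    refine ⟨add_nonneg hx1 hw0, ?_, C.add_mem hx1C hwC⟩
    calc x1 + (x - x1) ⊓ |s| ≤ x1 + (x - x1) := by gcongr; exact inf_le_left
      _ = x := by abel
  simpa using this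

theorem wp_isCompl [IsOrderedAddMonoid G] [PosSMulMono ℝ G] (hD : DedekindComplete G)
    (v : G) : IsCompl (wpDisj (wpDisj {v} : Set G)) (wpDisj ({v} : Set G)) := by
  constructor
  · rw [Submodule.disjoint_def]
    intro x hx hx'
    have := hx x hx'
    rw [inf_idem] at this
    exact wp_abs_zero this
  · rw [codisjoint_iff, eq_top_iff]
    have hpos : ∀ x : G, 0 ≤ x → x ∈ wpDisj (wpDisj {v} : Set G) ⊔ wpDisj ({v} : Set G) := by
      intro x hx
      obtain ⟨x1, -, -, h1, h2⟩ := wp_decomp hD v hx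
      have := Submodule.add_mem_sup h1 h2
      simpa using this
    intro x _
    rw [← posPart_sub_negPart x]
    exact Submodule.sub_mem _ (hpos _ (posPart_nonneg x)) (hpos _ (negPart_nonneg x))

/-- Principal band projections exist. -/
theorem wp_exists_bp [IsOrderedAddMonoid G] [PosSMulMono ℝ G] (hD : DedekindComplete G)
    (v : G) : ∃ η : Module.End ℝ G, IsBandProjection η ∧ η v = v ∧
      ∀ y : G, |v| ⊓ |y| = 0 → η y = 0 := by
  have hc := wp_isCompl hD v
  refine ⟨Submodule.projection _ _ hc, ⟨?_, ?_⟩, ?_, ?_⟩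
  · intro x
    exact Submodule.projection_eq_self_iff hc _ |>.2 (Submodule.projection_apply_mem hc x)
  · intro x hx
    obtain ⟨x1, h0, h1, h2, h3⟩ := wp_decomp hD v hx
    have : Submodule.projection _ _ hc x = x1 := by
      have e : x = x1 + (x - x1) := by abel
      rw [e, map_add, (Submodule.projection_eq_self_iff hc _).2 h2,
        (Submodule.projection_apply_eq_zero_iff hc).2 h3, add_zero]
    rw [this]
    exact ⟨h0, h1⟩
  · apply (Submodule.projection_eq_self_iff hc _).2
    intro s hs
    rw [inf_comm]; exact hs v rfl
  · intro y hy
    apply (Submodule.projection_apply_eq_zero_iff hc).2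
    rintro s rfl
    rw [inf_comm]; exact hy

section bp
variable [IsOrderedAddMonoid G]

theorem wp_ext {f g : Module.End ℝ G} (h : ∀ x, 0 ≤ x → f x = g x) : f = g := by
  ext x
  rw [← posPart_sub_negPart x, map_sub, map_sub, h _ (posPart_nonneg x), h _ (negPart_nonneg x)]

variable {p q : Module.End ℝ G}

theorem wp_idem (hp : IsBandProjection p) : p * p = p := LinearMap.ext hp.1

theorem wp_compl (hp : IsBandProjection p) : IsBandProjection (1 - p : Module.End ℝ G) := by
  refine ⟨fun x => ?_, fun x hx => ?_⟩
  · simp [hp.1]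
  · have := hp.2 x hx
    simp only [LinearMap.sub_apply, Module.End.one_apply]
    exact ⟨sub_nonneg.2 this.2, sub_le_self _ this.1⟩

theorem wp_one : IsBandProjection (1 : Module.End ℝ G) :=
  ⟨fun _ => rfl, fun _ hx => ⟨hx, le_rfl⟩⟩

theorem wp_mono (hp : IsBandProjection p) {x y : G} (h : x ≤ y) : p x ≤ p y := by
  have := (hp.2 _ (sub_nonneg.2 h)).1
  rw [map_sub] at this
  exact sub_nonneg.1 this

theorem wp_comm_aux (hp : IsBandProjection p) (hq : IsBandProjection q) : p * q * p = q * p := by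
  apply wp_ext
  intro x hx
  have h1 := hp.2 x hx
  have h2 := hq.2 _ h1.1
  have h3 := (wp_compl hp).2 _ h2.1
  have h4 := wp_mono (wp_compl hp) h2.2
  simp only [LinearMap.sub_apply, Module.End.one_apply, hp.1, sub_self] at h3 h4
  have := le_antisymm h4 h3.1
  exact (sub_eq_zero.1 this).symm

theorem wp_comm (hp : IsBandProjection p) (hq : IsBandProjection q) : p * q = q * p := by
  have h1 := wp_comm_aux hp hq
  have h2 := wp_comm_aux (wp_compl hp) hq
  have h3 := wp_idem hp
  have h4 : p * ((1 - p) * q * (1 - p)) = p * (q * (1 - p)) := by rw [h2]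
  have h5 : p * ((1 - p) * q * (1 - p)) = 0 := by
    have : p * (1 - p) = 0 := by rw [mul_sub, mul_one, h3, sub_self]
    rw [← mul_assoc, ← mul_assoc, this, zero_mul, zero_mul]
  rw [h5, mul_sub, mul_one, mul_sub, ← mul_assoc, h1] at h4
  exact (sub_eq_zero.1 h4.symm)

theorem wp_comm_apply (hp : IsBandProjection p) (hq : IsBandProjection q) (x : G) :
    p (q x) = q (p x) := LinearMap.congr_fun (wp_comm hp hq) x

theorem wp_mul (hp : IsBandProjection p) (hq : IsBandProjection q) : IsBandProjection (p * q) := by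
  refine ⟨fun x => ?_, fun x hx => ?_⟩
  · simp only [Module.End.mul_apply]
    rw [wp_comm_apply hq hp, hp.1, hq.1]
  · have h1 := hq.2 x hx
    have h2 := hp.2 _ h1.1
    exact ⟨h2.1, h2.2.trans h1.2⟩

theorem wp_disj_pos (hp : IsBandProjection p) {a b : G} (ha : 0 ≤ a) (hb : 0 ≤ b) (hpa : p a = a)
    (hpb : p b = 0) : a ⊓ b = 0 := by
  have h0 : 0 ≤ a ⊓ b := le_inf ha hb
  have h1 : p (a ⊓ b) ≤ 0 := hpb ▸ wp_mono hp inf_le_right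
  have h2 := wp_mono (wp_compl hp) (inf_le_left : a ⊓ b ≤ a)
  simp only [LinearMap.sub_apply, Module.End.one_apply, hpa, sub_self] at h2
  apply le_antisymm _ h0
  exact (sub_nonpos.1 h2).trans h1

theorem wp_abs (hp : IsBandProjection p) (x : G) : |p x| = p |x| := by
  apply le_antisymm
  · refine abs_le'.2 ⟨wp_mono hp (le_abs_self x), ?_⟩
    rw [← map_neg]
    exact wp_mono hp (neg_le_abs x)
  · have h1 := wp_mono (wp_compl hp) (le_abs_self x)
    have h3 : |x| ≤ |p x| + (1 - p : Module.End ℝ G) |x| := by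
      refine abs_le'.2 ⟨?_, ?_⟩
      · calc x = p x + (1 - p : Module.End ℝ G) x := by simp
          _ ≤ _ := add_le_add (le_abs_self _) (wp_mono (wp_compl hp) (le_abs_self x))
      · calc -x = -(p x) + (1 - p : Module.End ℝ G) (-x) := by simp
          _ ≤ _ := add_le_add (neg_le_abs _) (wp_mono (wp_compl hp) (neg_le_abs x))
    simp only [LinearMap.sub_apply, Module.End.one_apply] at h3
    have h4 : 0 ≤ |p x| + (|x| - p |x|) - |x| := sub_nonneg.2 h3
    have h5 : |p x| + (|x| - p |x|) - |x| = |p x| - p |x| := by abel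
    rw [h5] at h4
    exact sub_nonneg.1 h4

theorem wp_disj (hp : IsBandProjection p) {w y : G} (hy : p y = 0) (hw : p w = w) :
    |w| ⊓ |y| = 0 := by
  apply wp_disj_pos hp (abs_nonneg _) (abs_nonneg _)
  · rw [← wp_abs hp, hw]
  · rw [← wp_abs hp, hy, abs_zero]

theorem wp_unit {one : G} (hone : IsWeakOrderUnit one) (hp : IsBandProjection p) (h : p one = 0) :
    p = 0 := by
  apply wp_ext
  intro z hz
  exact hone.2 _ (hp.2 z hz).1 (wp_disj_pos hp (hp.2 z hz).1 hone.1.le (hp.1 z) h)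

variable [PosSMulMono ℝ G]

/-- Support projections. -/
theorem wp_supp (hD : DedekindComplete G) (v : G) : ∃ η : Module.End ℝ G, IsBandProjection η ∧
    η v = v ∧ (∀ y : G, |v| ⊓ |y| = 0 → η y = 0) ∧
    ∀ κ : Module.End ℝ G, IsBandProjection κ → κ v = 0 → κ * η = 0 := by
  obtain ⟨η, h1, h2, h3⟩ := wp_exists_bp hD v
  refine ⟨η, h1, h2, h3, fun κ hκ hv => ?_⟩
  rw [wp_comm hκ h1]
  ext z
  simp only [Module.End.mul_apply, LinearMap.zero_apply]
  apply h3
  rw [inf_comm]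
  exact wp_disj hκ hv (hκ.1 z)

theorem wp_loc_zero (hD : DedekindComplete G) {v : G}
    (h : ∀ σ : Module.End ℝ G, IsBandProjection σ → σ ≠ 0 →
      ∃ τ : Module.End ℝ G, IsBandProjection τ ∧ τ ≠ 0 ∧ τ * σ = τ ∧ τ v = 0) : v = 0 := by
  obtain ⟨η, h1, h2, -, h4⟩ := wp_supp hD v
  by_cases hη : η = 0
  · rw [← h2, hη]; rfl
  · obtain ⟨τ, t1, t2, t3, t4⟩ := h η h1 hη
    exact absurd (t3.symm.trans (h4 τ t1 t4)) t2

theorem wp_loc_pos (hD : DedekindComplete G) (w : G) {τ : Module.End ℝ G}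
    (hτ : IsBandProjection τ) : τ w ≤ 0 ∨ ∃ σ : Module.End ℝ G, IsBandProjection σ ∧ σ ≠ 0 ∧
      σ * τ = σ ∧ 0 ≤ σ w ∧
      ∀ κ : Module.End ℝ G, IsBandProjection κ → κ * σ = κ → κ w = 0 → κ = 0 := by
  by_cases hw : (τ w)⁺ = 0
  · left; exact posPart_eq_zero.1 hw
  · right
    obtain ⟨η, h1, h2, h3, h4⟩ := wp_supp hD (τ w)⁺
    have e : η (τ w) = (τ w)⁺ := by
      have : η (τ w)⁻ = 0 := by
        apply h3
        rw [abs_of_nonneg (posPart_nonneg _), abs_of_nonneg (negPart_nonneg _)]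
        exact posPart_inf_negPart_eq_zero _
      conv_lhs => rw [← posPart_sub_negPart (τ w), map_sub, h2, this, sub_zero]
    refine ⟨η * τ, wp_mul h1 hτ, ?_, ?_, ?_, ?_⟩
    · intro h
      apply hw
      rw [← e, ← Module.End.mul_apply, h]; rfl
    · rw [mul_assoc, wp_idem hτ]
    · rw [Module.End.mul_apply, e]
      exact posPart_nonneg _
    · intro κ hκ hk h0
      have : κ (τ w)⁺ = 0 := by
        rw [← e, ← Module.End.mul_apply, ← Module.End.mul_apply, mul_assoc, hk, h0]
      rw [← hk, ← mul_assoc, h4 κ hκ this, zero_mul]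

end bp

section main
variable [IsOrderedAddMonoid G]

/-- Maximal disjoint families of projections. -/
theorem wp_zorn (P : Set (Module.End ℝ G)) (hP : ∀ p ∈ P, IsBandProjection p) :
    ∃ A ⊆ P, A.Pairwise (fun p q => p * q = 0) ∧
      ∀ σ ∈ P, (∀ τ ∈ A, σ * τ = 0) → σ = 0 := by
  obtain ⟨A, hA⟩ := zorn_subset {A : Set (Module.End ℝ G) | A ⊆ P ∧
    A.Pairwise (fun p q => p * q = 0)} (by
      intro c hc hchain
      refine ⟨⋃₀ c, ⟨Set.sUnion_subset fun s hs => (hc hs).1, ?_⟩, fun s hs =>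
        Set.subset_sUnion_of_mem hs⟩
      exact (Set.pairwise_sUnion hchain.directedOn).2 fun s hs => (hc hs).2)
  refine ⟨A, hA.prop.1, hA.prop.2, fun σ hσ h => ?_⟩
  have hmem : insert σ A ∈ {A : Set (Module.End ℝ G) | A ⊆ P ∧
      A.Pairwise (fun p q => p * q = 0)} := by
    refine ⟨Set.insert_subset hσ hA.prop.1, ?_⟩
    refine hA.prop.2.insert fun τ hτ _ => ⟨h τ hτ, ?_⟩
    rw [wp_comm (hP _ (hA.prop.1 hτ)) (hP _ hσ)]
    exact h τ hτ
  have : σ ∈ A := hA.le_of_ge hmem (Set.subset_insert _ _) (Set.mem_insert _ _)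
  have h2 := h σ this
  rwa [wp_idem (hP _ hσ)] at h2

/-- Local one-dimensionality, phrased with projections. -/
def WpLoc (one : G) : Prop :=
  ∀ x : G, 0 ≤ x → ∀ π : Module.End ℝ G, IsBandProjection π → π ≠ 0 →
    ∃ ρ : Module.End ℝ G, IsBandProjection ρ ∧ ρ ≠ 0 ∧ ρ * π = ρ ∧ ∃ c : ℝ, ρ x = c • ρ one

variable [PosSMulMono ℝ G]

theorem wp_loc_of_const {one : G} (hone : IsWeakOrderUnit one)
    (h : ∀ x : G, 0 ≤ x → LocallyConstantWrt x one) : WpLoc one := by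
  intro x hx π hπ hπ0
  obtain ⟨ι, lam, p, hp, hd, hl⟩ := h x hx
  by_cases hex : ∃ ξ, (p ξ : Module.End ℝ G) * π ≠ 0
  · obtain ⟨ξ, hξ⟩ := hex
    refine ⟨(p ξ : Module.End ℝ G) * π, wp_mul (hp ξ) hπ, hξ, by rw [mul_assoc, wp_idem hπ],
      max (lam ξ) 0, ?_⟩
    have h1 : p ξ one ≥ 0 := ((hp ξ).2 one hone.1.le).1
    have key : p ξ x = max (lam ξ) 0 • p ξ one := by
      apply le_antisymm
      · have : x ≤ max (lam ξ) 0 • p ξ one + (x - p ξ x) := by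
          apply hl.2
          rintro _ ⟨η, rfl⟩
          by_cases hη : η = ξ
          · subst hη
            exact (wp_smul_mono (le_max_left _ _) h1).trans
              (le_add_of_nonneg_right (sub_nonneg.2 ((hp η).2 x hx).2))
          · have h2 := wp_mono (wp_compl (hp ξ)) (hl.1 ⟨η, rfl⟩)
            simp only [LinearMap.sub_apply, Module.End.one_apply, map_smul,
              hd (Ne.symm hη), smul_zero, sub_zero] at h2
            exact h2.trans (le_add_of_nonneg_left (smul_nonneg (le_max_right _ _) h1))
        have h3 := sub_nonneg.2 this
        have e : max (lam ξ) 0 • p ξ one + (x - p ξ x) - x = max (lam ξ) 0 • p ξ one - p ξ x := by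
          abel
        rw [e] at h3
        exact sub_nonneg.1 h3
      · rcases max_cases (lam ξ) 0 with ⟨e, -⟩ | ⟨e, -⟩
        · rw [e]
          have h2 := wp_mono (hp ξ) (hl.1 ⟨ξ, rfl⟩)
          simpa only [map_smul, (hp ξ).1] using h2
        · rw [e, zero_smul]
          exact ((hp ξ).2 x hx).1
    rw [wp_comm (hp ξ) hπ]
    simp only [Module.End.mul_apply]
    rw [key, map_smul]
  · push Not at hex
    refine ⟨π, hπ, hπ0, wp_idem hπ, 0, ?_⟩
    rw [zero_smul]
    apply le_antisymm _ (hπ.2 x hx).1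
    have : x ≤ x - π x := by
      apply hl.2
      rintro _ ⟨η, rfl⟩
      have h2 := wp_mono (wp_compl hπ) (hl.1 ⟨η, rfl⟩)
      have h3 : π (p η one) = 0 := by
        rw [wp_comm_apply hπ (hp η)]
        exact LinearMap.congr_fun (hex η) one
      simpa only [LinearMap.sub_apply, Module.End.one_apply, map_smul, h3, smul_zero,
        sub_zero] using h2
    have h3 := sub_nonneg.2 this
    simpa using h3

theorem wp_const_of_loc (hD : DedekindComplete G) {one : G}
    (h : WpLoc one) (x : G) (hx : 0 ≤ x) : LocallyConstantWrt x one := by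
  obtain ⟨A, hAP, hAd, hAm⟩ := wp_zorn {p : Module.End ℝ G | IsBandProjection p ∧
    ∃ c : ℝ, p x = c • p one} (fun p hp => hp.1)
  refine ⟨A, fun p => (hAP p.2).2.choose, fun p => p.1, fun p => (hAP p.2).1, ?_, ?_, ?_⟩
  · intro p q hpq y
    exact LinearMap.congr_fun (hAd p.2 q.2 (fun e => hpq (Subtype.ext e))) y
  · rintro _ ⟨p, rfl⟩
    have := (hAP p.2).2.choose_spec
    simp only
    rw [← this]
    exact ((hAP p.2).1.2 x hx).2
  · intro b hb
    rcases wp_loc_pos hD (x - b) wp_one with h1 | ⟨σ, s1, s2, -, s4, s5⟩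
    · exact sub_nonpos.1 h1
    · exfalso
      obtain ⟨ρ, r1, r2, r3, r4⟩ := h x hx σ s1 s2
      have : ∃ τ ∈ A, ρ * τ ≠ 0 := by
        by_contra hcon
        push Not at hcon
        exact r2 (hAm ρ ⟨r1, r4⟩ hcon)
      obtain ⟨τ, hτA, hτ⟩ := this
      have t1 := (hAP hτA).1
      have hb' := wp_mono t1 (hb ⟨⟨τ, hτA⟩, rfl⟩)
      have hc := (hAP hτA).2.choose_spec
      simp only at hb'
      rw [← hc, t1.1] at hb'
      have hle : τ (x - b) ≤ 0 := by rw [map_sub]; exact sub_nonpos.2 hb'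
      have hk : ρ * τ * σ = ρ * τ := by
        rw [mul_assoc, wp_comm t1 s1, ← mul_assoc, r3]
      apply hτ
      apply s5 _ (wp_mul r1 t1) hk
      apply le_antisymm
      · have := wp_mono r1 hle
        simpa using this
      · rw [← hk, Module.End.mul_apply]
        exact ((wp_mul r1 t1).2 _ s4).1

/-- Band preserving operators commute with band projections. -/
theorem wp_bp_comm {T : Module.End ℝ G}
    (hT : ∀ x y : G, |x| ⊓ |y| = 0 → |T x| ⊓ |y| = 0) {p : Module.End ℝ G}
    (hp : IsBandProjection p) (x : G) : p (T x) = T (p x) := by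
  have key : ∀ {p : Module.End ℝ G}, IsBandProjection p → ∀ x, T (p x) = p (T (p x)) := by
    intro p hp x
    have h1 := hT (p x) ((1 - p : Module.End ℝ G) (T (p x))) (by
      apply wp_disj hp _ (hp.1 x)
      simp [hp.1])
    have h2 : |(1 - p : Module.End ℝ G) (T (p x))| ≤ |T (p x)| := by
      rw [wp_abs (wp_compl hp)]
      exact ((wp_compl hp).2 _ (abs_nonneg _)).2
    rw [inf_eq_right.2 h2] at h1
    have h3 := wp_abs_zero h1
    simp only [LinearMap.sub_apply, Module.End.one_apply] at h3
    exact sub_eq_zero.1 h3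
  have h1 := key hp x
  have h2 := key (wp_compl hp) x
  have h3 : p (T ((1 - p : Module.End ℝ G) x)) = 0 := by
    rw [h2]; simp [hp.1]
  simp only [LinearMap.sub_apply, Module.End.one_apply, map_sub] at h3
  rw [h1]
  exact sub_eq_zero.1 h3

theorem wp_forward (hD : DedekindComplete G) {one : G} (hone : IsWeakOrderUnit one)
    (h : WpLoc one) (T : Module.End ℝ G)
    (hT : ∀ x y : G, |x| ⊓ |y| = 0 → |T x| ⊓ |y| = 0) {e x : G} (hx : 0 ≤ x) (hxe : x ≤ e) :
    |T x| ≤ |T e| := by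
  rcases wp_loc_pos hD (|T x| - |T e|) wp_one with h1 | ⟨σ, s1, s2, -, s4, s5⟩
  · exact sub_nonpos.1 h1
  · exfalso
    obtain ⟨ρ', r1', r2', r3', c', hc'⟩ := h x hx σ s1 s2
    obtain ⟨ρ, r1, r2, r3, d, hd⟩ := h e (hx.trans hxe) ρ' r1' r2'
    have hc : ρ x = c' • ρ one := by
      rw [← r3, Module.End.mul_apply, hc', map_smul, Module.End.mul_apply]
    have hk : ρ * σ = ρ := by rw [← r3, mul_assoc, r3']
    have hone' : 0 ≤ ρ one := (r1.2 one hone.1.le).1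
    have hne : ρ one ≠ 0 := fun h0 => r2 (wp_unit hone r1 h0)
    have hneg : ∀ a b : ℝ, a • ρ one ≤ b • ρ one → a ≤ b := by
      intro a b hab
      by_contra! hlt
      have h1 : (a - b) • ρ one ≤ 0 := by rw [sub_smul]; exact sub_nonpos.2 hab
      have h2 := smul_le_smul_of_nonneg_left h1 (inv_nonneg.2 (sub_pos.2 hlt).le)
      rw [smul_smul, inv_mul_cancel₀ (sub_pos.2 hlt).ne', one_smul, smul_zero] at h2
      exact hne (le_antisymm h2 hone')
    have hc0 : 0 ≤ c' := hneg 0 c' (by rw [zero_smul, ← hc]; exact (r1.2 x hx).1)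
    have hcd : c' ≤ d := hneg c' d (by rw [← hc, ← hd]; exact wp_mono r1 hxe)
    have hTx : ρ |T x| = |c' • T (ρ one)| := by
      rw [← wp_abs r1, wp_bp_comm hT r1, hc, map_smul]
    have hTe : ρ |T e| = |d • T (ρ one)| := by
      rw [← wp_abs r1, wp_bp_comm hT r1, hd, map_smul]
    have hle : |c' • T (ρ one)| ≤ |d • T (ρ one)| := by
      rcases hc0.eq_or_lt with h0 | h0
      · rw [← h0, zero_smul, abs_zero]; exact abs_nonneg _
      · have hd0 : 0 < d := h0.trans_le hcd
        have e1 : c' • T (ρ one) = (c' / d) • (d • T (ρ one)) := by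
          rw [smul_smul, div_mul_cancel₀ _ hd0.ne']
        rw [e1]
        refine (wp_abs_smul_le _ _).trans ?_
        rw [abs_of_nonneg (div_nonneg hc0 hd0.le)]
        have := wp_smul_mono ((div_le_one hd0).2 hcd) (abs_nonneg (d • T (ρ one)))
        rwa [one_smul] at this
    apply r2
    apply s5 ρ r1 hk
    apply le_antisymm
    · rw [map_sub, hTx, hTe]; exact sub_nonpos.2 hle
    · rw [← hk, Module.End.mul_apply]
      exact (r1.2 _ s4).1

theorem wp_glue_pos (hUC : UniversallyComplete G) (A : Set (Module.End ℝ G))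
    (hA : ∀ p ∈ A, IsBandProjection p) (hd : A.Pairwise (fun p q => p * q = 0))
    (f : Module.End ℝ G → G) (hf0 : ∀ p ∈ A, 0 ≤ f p) (hf : ∀ p ∈ A, p (f p) = f p) :
    ∃ m : G, ∀ p ∈ A, p m = f p := by
  rcases A.eq_empty_or_nonempty with rfl | hne
  · exact ⟨0, by simp⟩
  have hz : ∀ p ∈ A, ∀ q ∈ A, p ≠ q → p (f q) = 0 := by
    intro p hp q hq hpq
    rw [← hf q hq]
    exact LinearMap.congr_fun (hd hp hq hpq) _
  have hb : BddAbove (f '' A) := by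
    apply hUC.2
    · rintro _ ⟨p, hp, rfl⟩
      exact hf0 p hp
    · rintro _ ⟨p, hp, rfl⟩ _ ⟨q, hq, rfl⟩ hne
      exact wp_disj_pos (hA p hp) (hf0 p hp) (hf0 q hq) (hf p hp)
        (hz p hp q hq (fun e => hne (by rw [e])))
  obtain ⟨m, hm⟩ := hUC.1 _ (hne.image f) hb
  refine ⟨m, fun p hp => ?_⟩
  have hm0 : 0 ≤ m := (hf0 p hp).trans (hm.1 ⟨p, hp, rfl⟩)
  apply le_antisymm
  · have : m ≤ f p + (m - p m) := by
      apply hm.2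
      rintro _ ⟨q, hq, rfl⟩
      by_cases hqp : p = q
      · subst hqp
        exact le_add_of_nonneg_right (sub_nonneg.2 ((hA p hp).2 m hm0).2)
      · have h2 := wp_mono (wp_compl (hA p hp)) (hm.1 ⟨q, hq, rfl⟩)
        simp only [LinearMap.sub_apply, Module.End.one_apply, hz p hp q hq hqp, sub_zero] at h2
        exact h2.trans (le_add_of_nonneg_left (hf0 p hp))
    have h3 := sub_nonneg.2 this
    have e : f p + (m - p m) - m = f p - p m := by abel
    rw [e] at h3
    exact sub_nonneg.1 h3
  · have := wp_mono (hA p hp) (hm.1 ⟨p, hp, rfl⟩)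
    rwa [hf p hp] at this

theorem wp_glue (hUC : UniversallyComplete G) (P : Set (Module.End ℝ G))
    (hP : ∀ p ∈ P, IsBandProjection p)
    (hI : ∀ p ∈ P, ∀ q : Module.End ℝ G, IsBandProjection q → q * p ∈ P)
    (f : Module.End ℝ G → G)
    (hf : ∀ p ∈ P, ∀ q : Module.End ℝ G, IsBandProjection q → f (q * p) = q (f p)) :
    ∃ m : G, ∀ p ∈ P, p m = f p := by
  obtain ⟨A, hAP, hAd, hAm⟩ := wp_zorn P hP
  have hA : ∀ p ∈ A, IsBandProjection p := fun p hp => hP p (hAP hp)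
  have hff : ∀ p ∈ A, p (f p) = f p := by
    intro p hp
    rw [← hf p (hAP hp) p (hA p hp), wp_idem (hA p hp)]
  have hpos : ∀ p ∈ A, p (f p)⁺ = (f p)⁺ ∧ p (f p)⁻ = (f p)⁻ := by
    intro p hp
    have h1 := (wp_compl (hA p hp)).2 |f p| (abs_nonneg _)
    have h0 : (1 - p : Module.End ℝ G) |f p| = 0 := by
      rw [← wp_abs (wp_compl (hA p hp))]
      simp [hff p hp]
    have key : ∀ z : G, 0 ≤ z → z ≤ |f p| → p z = z := by
      intro z hz hz'
      have h2 := wp_mono (wp_compl (hA p hp)) hz'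
      rw [h0] at h2
      have h3 := le_antisymm h2 ((wp_compl (hA p hp)).2 z hz).1
      simp only [LinearMap.sub_apply, Module.End.one_apply] at h3
      exact (sub_eq_zero.1 h3).symm
    have habs := posPart_add_negPart (f p)
    exact ⟨key _ (posPart_nonneg _) (habs ▸ le_add_of_nonneg_right (negPart_nonneg _)),
      key _ (negPart_nonneg _) (habs ▸ le_add_of_nonneg_left (posPart_nonneg _))⟩
  obtain ⟨m1, hm1⟩ := wp_glue_pos hUC A hA hAd (fun p => (f p)⁺) (fun p _ => posPart_nonneg _)
    (fun p hp => (hpos p hp).1)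
  obtain ⟨m2, hm2⟩ := wp_glue_pos hUC A hA hAd (fun p => (f p)⁻) (fun p _ => negPart_nonneg _)
    (fun p hp => (hpos p hp).2)
  refine ⟨m1 - m2, fun σ hσ => ?_⟩
  have hmA : ∀ τ ∈ A, τ (m1 - m2) = f τ := by
    intro τ hτ
    rw [map_sub, hm1 τ hτ, hm2 τ hτ, posPart_sub_negPart]
  have hσ' := hP σ hσ
  obtain ⟨η, h1, h2, -, h4⟩ := wp_supp hUC.1 (σ (m1 - m2) - f σ)
  have hzero : η * σ = 0 := by
    apply hAm _ (hI σ hσ η h1)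
    intro τ hτ
    have hτ' := hA τ hτ
    have hk : τ * σ * η = 0 := by
      apply h4 _ (wp_mul hτ' hσ')
      have e1 : f (τ * σ) = τ (f σ) := hf σ hσ τ hτ'
      have e2 : f (τ * σ) = σ (f τ) := by rw [wp_comm hτ' hσ', hf τ (hAP hτ) σ hσ']
      have e3 : f σ = σ (f σ) := by rw [← hf σ hσ σ hσ', wp_idem hσ']
      rw [Module.End.mul_apply, map_sub, map_sub, hσ'.1, ← e3, wp_comm_apply hτ' hσ', hmA τ hτ,
        ← e1, ← e2, sub_self]
    rw [← wp_comm hτ' (wp_mul h1 hσ'), wp_comm h1 hσ', ← mul_assoc, hk]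
  have e3 : f σ = σ (f σ) := by rw [← hf σ hσ σ hσ', wp_idem hσ']
  have : σ (m1 - m2) - f σ = 0 := by
    rw [← h2]
    have : σ (m1 - m2) - f σ = σ (m1 - m2 - f σ) := by
      rw [map_sub σ (m1 - m2), ← e3]
    rw [this, ← Module.End.mul_apply, hzero]; rfl
  exact sub_eq_zero.1 this

/-- The algebra generated by band projections. -/
abbrev WpR (G : Type u) [Lattice G] [AddCommGroup G] [Module ℝ G] :
    Subalgebra ℝ (Module.End ℝ G) :=
  Algebra.adjoin ℝ {p : Module.End ℝ G | IsBandProjection p}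

theorem wp_adjoin_local {r : Module.End ℝ G} (hr : r ∈ WpR G) :
    ∀ σ : Module.End ℝ G, IsBandProjection σ → σ ≠ 0 →
      ∃ τ : Module.End ℝ G, IsBandProjection τ ∧ τ ≠ 0 ∧ τ * σ = τ ∧
        ∃ c : ℝ, r * τ = c • τ ∧ τ * r = c • τ := by
  induction hr using Algebra.adjoin_induction with
  | mem ρ hρ =>
    intro σ hσ h0
    have hρ' : IsBandProjection ρ := hρ
    by_cases h : ρ * σ = 0
    · exact ⟨σ, hσ, h0, wp_idem hσ, 0, by rw [h, zero_smul],
        by rw [← wp_comm hρ' hσ, h, zero_smul]⟩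
    · refine ⟨ρ * σ, wp_mul hρ' hσ, h, by rw [mul_assoc, wp_idem hσ], 1, ?_, ?_⟩
      · rw [← mul_assoc, wp_idem hρ', one_smul]
      · rw [mul_assoc, ← wp_comm hρ' hσ, ← mul_assoc, wp_idem hρ', one_smul]
  | algebraMap c =>
    intro σ hσ h0
    refine ⟨σ, hσ, h0, wp_idem hσ, c, ?_, ?_⟩
    · rw [Algebra.algebraMap_eq_smul_one, smul_mul_assoc, one_mul]
    · rw [Algebra.algebraMap_eq_smul_one, mul_smul_comm, mul_one]
  | add x y _ _ hx hy =>
    intro σ hσ h0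
    obtain ⟨τ, t1, t2, t3, c, c1, c2⟩ := hx σ hσ h0
    obtain ⟨κ, k1, k2, k3, d, d1, d2⟩ := hy τ t1 t2
    have k3' : τ * κ = κ := by rw [wp_comm t1 k1, k3]
    refine ⟨κ, k1, k2, by rw [← k3, mul_assoc, t3], c + d, ?_, ?_⟩
    · rw [add_mul, d1, add_smul]
      congr 1
      rw [← k3', ← mul_assoc, c1, smul_mul_assoc]
    · rw [mul_add, d2, add_smul]
      congr 1
      rw [← k3, mul_assoc, c2, mul_smul_comm]
  | mul x y _ _ hx hy =>
    intro σ hσ h0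
    obtain ⟨τ, t1, t2, t3, c, c1, c2⟩ := hx σ hσ h0
    obtain ⟨κ, k1, k2, k3, d, d1, d2⟩ := hy τ t1 t2
    have k3' : τ * κ = κ := by rw [wp_comm t1 k1, k3]
    have e1 : x * κ = c • κ := by rw [← k3', ← mul_assoc, c1, smul_mul_assoc]
    have e2 : κ * x = c • κ := by rw [← k3, mul_assoc, c2, mul_smul_comm]
    refine ⟨κ, k1, k2, by rw [← k3, mul_assoc, t3], c * d, ?_, ?_⟩
    · rw [mul_assoc, d1, mul_smul_comm, e1, smul_smul, mul_comm]
    · rw [← mul_assoc, e2, smul_mul_assoc, d2, smul_smul]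

theorem wp_smul_def (r : WpR G) (m : G) : r • m = (r : Module.End ℝ G) m := rfl

theorem wp_baer (hUC : UniversallyComplete G) : Module.Baer (WpR G) G := by
  classical
  intro I g
  let F : Module.End ℝ G → G := fun p =>
    if h : ∃ hp : p ∈ WpR G, (⟨p, hp⟩ : WpR G) ∈ I then g ⟨⟨p, h.1⟩, h.2⟩ else 0
  have hF : ∀ (r : WpR G) (hr : r ∈ I), F r = g ⟨r, hr⟩ := by
    intro r hr
    have h : ∃ hp : (r : Module.End ℝ G) ∈ WpR G, (⟨r, hp⟩ : WpR G) ∈ I := ⟨r.2, hr⟩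
    simp only [F]
    rw [dif_pos h]
  have hFm : ∀ (r s : WpR G), r ∈ I → F (s * r) = (s : Module.End ℝ G) (F r) := by
    intro r s hr
    have h2 := hF (s * r) (I.mul_mem_left s hr)
    have h3 := g.map_smul s ⟨r, hr⟩
    rw [hF r hr, ← wp_smul_def, ← h3]
    exact h2
  have hbpR : ∀ p : Module.End ℝ G, IsBandProjection p → p ∈ WpR G :=
    fun p hp => Algebra.subset_adjoin hp
  obtain ⟨m, hm⟩ := wp_glue hUC
    {p | IsBandProjection p ∧ ∃ hp : p ∈ WpR G, (⟨p, hp⟩ : WpR G) ∈ I}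
    (fun p hp => hp.1)
    (by
      rintro p ⟨hp, hpR, hpI⟩ q hq
      exact ⟨wp_mul hq hp, mul_mem (hbpR q hq) hpR,
        I.mul_mem_left (⟨q, hbpR q hq⟩ : WpR G) hpI⟩)
    F
    (by
      rintro p ⟨hp, hpR, hpI⟩ q hq
      exact hFm ⟨p, hpR⟩ ⟨q, hbpR q hq⟩ hpI)
  refine ⟨LinearMap.toSpanSingleton (WpR G) G m, fun r hr => ?_⟩
  rw [← hF r hr, LinearMap.toSpanSingleton_apply, wp_smul_def, ← sub_eq_zero]
  apply wp_loc_zero hUC.1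
  intro σ hσ h0
  obtain ⟨τ, t1, t2, t3, c, c1, c2⟩ := wp_adjoin_local r.2 σ hσ h0
  refine ⟨τ, t1, t2, t3, ?_⟩
  have e1 : τ (F r) = F (τ * r) := (hFm r ⟨τ, hbpR τ t1⟩ hr).symm
  have hmemI : (⟨τ, hbpR τ t1⟩ : WpR G) * r ∈ I := I.mul_mem_left _ hr
  have e2 : τ ((r : Module.End ℝ G) m) = c • τ m := by
    rw [← Module.End.mul_apply, c2]; rfl
  rw [map_sub, e1, e2]
  by_cases hc : c = 0
  · have : F (τ * r) = 0 := by
      rw [c2, hc, zero_smul]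
      have := hF 0 I.zero_mem
      exact this.trans (map_zero g)
    rw [this, hc, zero_smul, sub_zero]
  · have eτ : (⟨τ, hbpR τ t1⟩ : WpR G) =
        (algebraMap ℝ (WpR G) c⁻¹) * ((⟨τ, hbpR τ t1⟩ : WpR G) * r) := by
      apply Subtype.ext
      change τ = algebraMap ℝ (Module.End ℝ G) c⁻¹ * (τ * r)
      rw [c2, Algebra.algebraMap_eq_smul_one, smul_mul_assoc, one_mul, smul_smul,
        inv_mul_cancel₀ hc, one_smul]
    have hτI : (⟨τ, hbpR τ t1⟩ : WpR G) ∈ I := by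
      rw [eτ]
      exact I.mul_mem_left _ hmemI
    have e3 : F (τ * r) = c • F τ := by
      have h5 := hFm ⟨τ, hbpR τ t1⟩ (algebraMap ℝ (WpR G) c) hτI
      have h6 : (algebraMap ℝ (WpR G) c : Module.End ℝ G) = c • 1 := by
        rw [← Algebra.algebraMap_eq_smul_one]; rfl
      rw [h6] at h5
      simp only [smul_mul_assoc, one_mul] at h5
      rw [c2, h5]; rfl
    rw [e3, hm τ ⟨t1, hbpR τ t1, hτI⟩, sub_self]

theorem wp_exists_T (hUC : UniversallyComplete G) {one x : G}
    {π : Module.End ℝ G} (hπ : IsBandProjection π)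
    (hnot : ∀ ρ : Module.End ℝ G, IsBandProjection ρ → ρ ≠ 0 → ρ * π = ρ →
      ∀ c : ℝ, ρ x ≠ c • ρ one) :
    ∃ T : Module.End ℝ G, (∀ x y : G, |x| ⊓ |y| = 0 → |T x| ⊓ |y| = 0) ∧
      (∀ p : Module.End ℝ G, IsBandProjection p → ∀ z, T (p z) = p (T z)) ∧
      T one = 0 ∧ T (π x) = π one := by
  have hbpR : ∀ p : Module.End ℝ G, IsBandProjection p → p ∈ WpR G :=
    fun p hp => Algebra.subset_adjoin hp
  let L : Submodule (WpR G) G := Submodule.span (WpR G) {one}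
  let φ : WpR G →ₗ[WpR G] (G ⧸ L) := L.mkQ ∘ₗ LinearMap.toSpanSingleton (WpR G) G (π x)
  let ψ : WpR G →ₗ[WpR G] G := LinearMap.toSpanSingleton (WpR G) G (π one)
  have hker : LinearMap.ker φ ≤ LinearMap.ker ψ := by
    intro r hr
    have hr' : r • π x ∈ L := by
      have : L.mkQ (r • π x) = 0 := hr
      rwa [Submodule.mkQ_apply, Submodule.Quotient.mk_eq_zero] at this
    obtain ⟨s, hs⟩ := Submodule.mem_span_singleton.1 hr'
    change r • π one = 0
    rw [wp_smul_def] at hs ⊢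
    rw [wp_smul_def] at hs
    apply wp_loc_zero hUC.1
    intro σ hσ h0
    by_cases hσπ : σ * π = 0
    · obtain ⟨τ, t1, t2, t3, c, c1, c2⟩ := wp_adjoin_local r.2 σ hσ h0
      refine ⟨τ, t1, t2, t3, ?_⟩
      rw [← Module.End.mul_apply, c2, ← t3, LinearMap.smul_apply, Module.End.mul_apply,
        ← Module.End.mul_apply σ, hσπ]
      simp
    · obtain ⟨τ, t1, t2, t3, c, c1, c2⟩ := wp_adjoin_local r.2 (σ * π) (wp_mul hσ hπ) hσπ
      obtain ⟨κ, k1, k2, k3, d, d1, d2⟩ := wp_adjoin_local s.2 τ t1 t2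
      have tπ : τ * π = τ := by rw [← t3, mul_assoc, mul_assoc, wp_idem hπ]
      have tσ : τ * σ = τ := by
        rw [← t3, mul_assoc, wp_comm hσ hπ, mul_assoc, wp_idem hσ]
      have kπ : κ * π = κ := by rw [← k3, mul_assoc, tπ]
      have kσ : κ * σ = κ := by rw [← k3, mul_assoc, tσ]
      have kr : κ * (r : Module.End ℝ G) = c • κ := by rw [← k3, mul_assoc, c2, mul_smul_comm]
      refine ⟨κ, k1, k2, kσ, ?_⟩
      have e1 : κ ((s : Module.End ℝ G) one) = d • κ one := by
        rw [← Module.End.mul_apply, d2]; rfl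
      have e2 : ∀ z : G, κ ((r : Module.End ℝ G) (π z)) = c • κ z := by
        intro z
        rw [← Module.End.mul_apply, kr, LinearMap.smul_apply, ← Module.End.mul_apply, kπ]
      rw [e2]
      by_cases hc : c = 0
      · rw [hc, zero_smul]
      · exfalso
        apply hnot κ k1 k2 kπ (c⁻¹ * d)
        rw [mul_smul, ← e1, hs, e2, smul_smul, inv_mul_cancel₀ hc, one_smul]
  let i : (WpR G ⧸ LinearMap.ker φ) →ₗ[WpR G] (G ⧸ L) := (LinearMap.ker φ).liftQ φ le_rfl
  have hi : Function.Injective i := by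
    rw [← LinearMap.ker_eq_bot]
    exact Submodule.ker_liftQ_eq_bot _ _ _ le_rfl
  let f : (WpR G ⧸ LinearMap.ker φ) →ₗ[WpR G] G := (LinearMap.ker φ).liftQ ψ hker
  obtain ⟨h, hh⟩ := (wp_baer hUC).extension_property i hi f
  let T' : G →ₗ[WpR G] G := h ∘ₗ L.mkQ
  let T : Module.End ℝ G :=
    { toFun := T'
      map_add' := T'.map_add
      map_smul' := by
        intro c z
        have h1 := T'.map_smul (algebraMap ℝ (WpR G) c) z
        have h2 : ∀ z : G, (algebraMap ℝ (WpR G) c) • z = c • z := fun z => rfl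
        rw [h2, h2] at h1
        exact h1 }
  have hTc : ∀ p : Module.End ℝ G, IsBandProjection p → ∀ z, T (p z) = p (T z) :=
    fun p hp z => T'.map_smul (⟨p, hbpR p hp⟩ : WpR G) z
  refine ⟨T, ?_, hTc, ?_, ?_⟩
  · intro a b hab
    obtain ⟨η, h1, h2, h3⟩ := wp_exists_bp hUC.1 a
    apply wp_disj h1 (h3 b hab)
    rw [← hTc η h1, h2]
  · change h (L.mkQ one) = 0
    have : L.mkQ one = 0 := by
      rw [Submodule.mkQ_apply, Submodule.Quotient.mk_eq_zero]
      exact Submodule.mem_span_singleton_self one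
    rw [this, map_zero]
  · have h1 := LinearMap.congr_fun hh (Submodule.Quotient.mk 1)
    have h2 : i (Submodule.Quotient.mk 1) = L.mkQ (π x) := by
      change L.mkQ ((1 : WpR G) • π x) = _
      rw [one_smul]
    have h3 : f (Submodule.Quotient.mk 1) = π one := by
      change (1 : WpR G) • π one = _
      rw [one_smul]
    rw [LinearMap.comp_apply, h2, h3] at h1
    exact h1

theorem wp_arch (hD : DedekindComplete G) {a b : G} (ha : 0 ≤ a)
    (h : ∀ n : ℕ, (n : ℝ) • a ≤ b) : a = 0 := by
  obtain ⟨s, hs⟩ := hD (Set.range fun n : ℕ => (n : ℝ) • a) (Set.range_nonempty _)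
    ⟨b, by rintro _ ⟨n, rfl⟩; exact h n⟩
  have : s ≤ s - a := by
    apply hs.2
    rintro _ ⟨n, rfl⟩
    have := hs.1 ⟨n + 1, rfl⟩
    simp only at this
    push_cast at this
    rw [add_smul, one_smul] at this
    exact le_sub_iff_add_le.2 this
  have h3 := sub_nonneg.2 this
  apply le_antisymm _ ha
  simpa using h3

/-- Every element is locally bounded by a multiple of the unit. -/
theorem wp_loc_bdd (hD : DedekindComplete G) {one : G} (hone : IsWeakOrderUnit one) (y : G)
    {τ : Module.End ℝ G} (hτ : IsBandProjection τ) (h0 : τ ≠ 0) :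
    ∃ σ : Module.End ℝ G, IsBandProjection σ ∧ σ ≠ 0 ∧ σ * τ = σ ∧
      ∃ K : ℕ, σ y ≤ (K : ℝ) • σ one := by
  by_contra! hcon
  apply h0
  apply wp_unit hone hτ
  apply wp_arch hD (hτ.2 one hone.1.le).1 (b := τ y)
  intro n
  rcases wp_loc_pos hD ((n : ℝ) • one - y) hτ with h | ⟨σ, s1, s2, s3, s4, -⟩
  · rw [map_sub, map_smul] at h
    exact sub_nonpos.1 h
  · exfalso
    apply hcon σ s1 s2 s3 n
    rw [map_sub, map_smul] at s4
    exact sub_nonneg.1 s4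

theorem wp_loc_approx (hD : DedekindComplete G) {one : G} (y : G) (d : ℝ) (hd : 0 ≤ d)
    (hone : 0 ≤ one) (k : ℕ) :
    ∀ τ : Module.End ℝ G, IsBandProjection τ → τ ≠ 0 → 0 ≤ τ y → τ y ≤ ((k : ℝ) * d) • τ one →
    ∃ σ : Module.End ℝ G, IsBandProjection σ ∧ σ ≠ 0 ∧ σ * τ = σ ∧
      ∃ c : ℝ, 0 ≤ σ y - c • σ one ∧ σ y - c • σ one ≤ d • σ one := by
  induction k with
  | zero =>
    intro τ hτ h0 h1 h2
    refine ⟨τ, hτ, h0, wp_idem hτ, 0, by simpa using h1, ?_⟩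
    have : τ y ≤ 0 := by simpa using h2
    rw [zero_smul, sub_zero]
    exact this.trans (smul_nonneg hd (hτ.2 one hone).1)
  | succ k ih =>
    intro τ hτ h0 h1 h2
    rcases wp_loc_pos hD (((k : ℝ) * d) • one - y) hτ with h | ⟨σ, s1, s2, s3, s4, -⟩
    · refine ⟨τ, hτ, h0, wp_idem hτ, (k : ℝ) * d, ?_, ?_⟩
      · rw [map_sub, map_smul] at h
        exact sub_nonneg.2 (sub_nonpos.1 h)
      · rw [sub_le_iff_le_add, ← add_smul]
        convert h2 using 2
        push_cast; ring
    · rw [map_sub, map_smul] at s4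
      have hs : 0 ≤ σ y := by
        rw [← s3, Module.End.mul_apply]
        exact (s1.2 _ h1).1
      obtain ⟨ρ, r1, r2, r3, r4⟩ := ih σ s1 s2 hs (sub_nonneg.1 s4)
      exact ⟨ρ, r1, r2, by rw [← r3, mul_assoc, s3], r4⟩

theorem wp_backward (hUC : UniversallyComplete G) {one : G} (hone : IsWeakOrderUnit one)
    (h : ∀ T : G →ₗ[ℝ] G,
        (∀ x y : G, |x| ⊓ |y| = 0 → |T x| ⊓ |y| = 0) →
        ∀ e : G, 0 ≤ e → ∃ f : G, 0 ≤ f ∧ ∀ x : G, |x| ≤ e → |T x| ≤ f) : WpLoc one := by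
  intro x hx π hπ hπ0
  by_contra! hcon
  obtain ⟨T, hTb, hTc, hT1, hTx⟩ := wp_exists_T hUC (one := one) (x := x) hπ hcon
  obtain ⟨f, hf0, hf⟩ := h T hTb one hone.1.le
  obtain ⟨τ, t1, t2, t3, K, hK⟩ := wp_loc_bdd hUC.1 hone f hπ hπ0
  obtain ⟨σ, s1, s2, s3, M, hM⟩ := wp_loc_bdd hUC.1 hone x t1 t2
  set n : ℝ := (K : ℝ) + 1 with hn
  have hnpos : 0 < n := by positivity
  obtain ⟨k, hk⟩ := exists_nat_ge ((M : ℝ) * n)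
  have hMk : (M : ℝ) ≤ (k : ℝ) * n⁻¹ := by
    rw [← div_eq_mul_inv, le_div_iff₀ hnpos]; exact hk
  obtain ⟨ρ, r1, r2, r3, c, c1, c2⟩ := wp_loc_approx hUC.1 (one := one) x n⁻¹
    (inv_nonneg.2 hnpos.le) hone.1.le k σ s1 s2 (s1.2 x hx).1
    (hM.trans (wp_smul_mono hMk (s1.2 one hone.1.le).1))
  have rτ : ρ * τ = ρ := by rw [← r3, mul_assoc, s3]
  have rπ : ρ * π = ρ := by rw [← rτ, mul_assoc, t3]
  have hρ1 := r1.2 one hone.1.le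
  have hz := hf (n • (ρ x - c • ρ one)) (by
    rw [abs_of_nonneg (smul_nonneg hnpos.le c1)]
    have := smul_le_smul_of_nonneg_left c2 hnpos.le
    rw [smul_smul, mul_inv_cancel₀ hnpos.ne', one_smul] at this
    exact this.trans hρ1.2)
  have hTz : T (n • (ρ x - c • ρ one)) = n • ρ one := by
    have e1 : T (ρ x) = ρ one := by
      conv_lhs => rw [← rπ, Module.End.mul_apply, hTc ρ r1, hTx, ← Module.End.mul_apply, rπ]
    rw [map_smul, map_sub, map_smul, hTc ρ r1 one, hT1, map_zero, smul_zero, sub_zero, e1]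
  rw [hTz, abs_of_nonneg (smul_nonneg hnpos.le hρ1.1)] at hz
  have h1 := wp_mono r1 hz
  have h2 := wp_mono r1 hK
  rw [map_smul, r1.1] at h1
  rw [map_smul, ← Module.End.mul_apply, ← Module.End.mul_apply, rτ] at h2
  have h3 := h1.trans h2
  rw [hn, add_smul, one_smul] at h3
  have h4 : ρ one ≤ 0 := by simpa using h3
  exact r2 (wp_unit hone r1 (le_antisymm h4 hρ1.1))

end main

end WicksteadHelpers

/-- Theorem 1.2.5: a universally complete vector lattice is locally
one-dimensional iff every band preserving linear operator on it is order bounded. -/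
theorem locally_one_dimensional_iff_bandPreserving_orderBounded
    {G : Type u} [Lattice G] [AddCommGroup G] [Module ℝ G]
    (hVL : IsVectorLattice G) (hUC : UniversallyComplete G)
    (one : G) (hone : IsWeakOrderUnit one) :
    (∀ x : G, 0 ≤ x → LocallyConstantWrt x one) ↔
      ∀ T : G →ₗ[ℝ] G,
        (∀ x y : G, |x| ⊓ |y| = 0 → |T x| ⊓ |y| = 0) →
        ∀ e : G, 0 ≤ e → ∃ f : G, 0 ≤ f ∧ ∀ x : G, |x| ≤ e → |T x| ≤ f := by
  haveI : IsOrderedAddMonoid G :=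
    { add_le_add_left := fun a b h c => hVL.1 a b c h }
  haveI : PosSMulMono ℝ G := ⟨fun c hc a b hab => by
    have h1 := hVL.2 c (b - a) hc (sub_nonneg.2 hab)
    rw [smul_sub] at h1
    exact sub_nonneg.1 h1⟩
  constructor
  · intro h T hT e he
    have hloc := wp_loc_of_const hone h
    refine ⟨|T e| + |T e|, add_nonneg (abs_nonneg _) (abs_nonneg _), fun x hx => ?_⟩
    have habs := posPart_add_negPart x
    have h1 := wp_forward hUC.1 hone hloc T hT (posPart_nonneg x)
      ((habs ▸ le_add_of_nonneg_right (negPart_nonneg x) : x⁺ ≤ |x|).trans hx)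
    have h2 := wp_forward hUC.1 hone hloc T hT (negPart_nonneg x)
      ((habs ▸ le_add_of_nonneg_left (posPart_nonneg x) : x⁻ ≤ |x|).trans hx)
    calc |T x| = |T x⁺ + -(T x⁻)| := by rw [← sub_eq_add_neg, ← map_sub, posPart_sub_negPart]
      _ ≤ |T x⁺| + |-(T x⁻)| := abs_add_le _ _
      _ = |T x⁺| + |T x⁻| := by rw [abs_neg]
      _ ≤ _ := add_le_add h1 h2
  · intro h x hx
    exact wp_const_of_loc hUC.1 (wp_backward hUC hone h) x hx
end

section
/- Let G be a universally complete vector lattice endowed with a multiplication making it a semiprime f-algebra whose ring unit 𝟙 is a weak order unit. Then every order bounded ℝ-linear derivation D : G → G (an ℝ-linear map with D(uv) = D(u)·v + u·D(v) for all u, v ∈ G) is zero. -/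
universe u

/-- 3.3.4 (real case): every order bounded ℝ-linear derivation on a universally
complete semiprime `f`-algebra whose ring unit is a weak order unit is zero. -/
theorem orderBounded_derivation_eq_zero
    {G : Type u} [CommRing G] [Lattice G] [Module ℝ G]
    (hVL : IsVectorLattice G) (hUC : UniversallyComplete G)
    (hposmul : ∀ x y : G, 0 ≤ x → 0 ≤ y → 0 ≤ x * y)
    (hfalg : ∀ x y z : G, 0 ≤ x → 0 ≤ y → 0 ≤ z → x ⊓ y = 0 → (z * x) ⊓ y = 0)
    (hsemiprime : ∀ x y : G, 0 ≤ x → 0 ≤ y → (x * y = 0 ↔ x ⊓ y = 0))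
    (hone_pos : (0 : G) < 1)
    (hone_weak : ∀ x : G, 0 ≤ x → x ⊓ 1 = 0 → x = 0)
    (D : G →ₗ[ℝ] G)
    (hLeibniz : ∀ u v : G, D (u * v) = D u * v + u * D v)
    (hbd : ∀ e : G, 0 ≤ e → ∃ f : G, 0 ≤ f ∧ ∀ x : G, |x| ≤ e → |D x| ≤ f) :
    D = 0 := by
  have _i1 : IsOrderedAddMonoid G :=
    { add_le_add_left := fun a b h c => hVL.1 a b c h }
  have _i0 : ZeroLEOneClass G := ⟨hone_pos.le⟩
  have _i2 : IsOrderedRing G := IsOrderedRing.of_mul_nonneg hposmul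
  have hone : (0 : G) ≤ 1 := hone_pos.le
  -- Archimedean property
  have arch : ∀ d f : G, (∀ n : ℕ, n • d ≤ f) → d ≤ 0 := by
    intro d f h
    obtain ⟨s, hs⟩ := hUC.1 (Set.range fun n : ℕ => n • d) ⟨_, 0, rfl⟩
      ⟨f, by rintro _ ⟨n, rfl⟩; exact h n⟩
    have h2 : s ≤ s - d := by
      apply hs.2
      rintro _ ⟨n, rfl⟩
      have h3 : (n + 1) • d ≤ s := hs.1 ⟨n + 1, rfl⟩
      rw [succ_nsmul] at h3
      exact le_sub_iff_add_le.mpr h3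
    have h4 : s + d ≤ s + 0 := by
      rw [add_zero]; exact le_sub_iff_add_le.mp h2
    exact le_of_add_le_add_left h4
  have hpm : ∀ u : G, u⁺ * u⁻ = 0 := fun u =>
    (hsemiprime _ _ (posPart_nonneg u) (negPart_nonneg u)).2 (posPart_inf_negPart_eq_zero u)
  have hdec : ∀ u : G, u⁺ - u⁻ = u := fun u => posPart_sub_negPart u
  have habs : ∀ u : G, u⁺ + u⁻ = |u| := fun u => posPart_add_negPart u
  have abssq : ∀ u : G, |u| * |u| = u * u := by
    intro u
    have h := hpm u
    have h1 := hdec u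
    have h2 := habs u
    generalize u⁺ = a at *
    generalize u⁻ = b at *
    rw [← h2, ← h1]
    linear_combination 4 * h
  have absnn : ∀ u : G, 0 ≤ |u| := fun u => abs_nonneg u
  have sqnn : ∀ u : G, 0 ≤ u * u := fun u => by
    rw [← abssq]; exact mul_nonneg (absnn u) (absnn u)
  have abszero : ∀ u : G, |u| ≤ 0 → u = 0 := fun u h =>
    le_antisymm ((le_abs_self u).trans h) (by
      have := (neg_le_abs u).trans h
      exact neg_nonpos.mp this)
  have red : ∀ u : G, u * u = 0 → u = 0 := by
    intro u h
    rw [← abssq] at h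
    have h2 := (hsemiprime _ _ (absnn u) (absnn u)).1 h
    rw [inf_idem] at h2
    exact abszero u h2.le
  have sqinj : ∀ p q : G, 0 ≤ p → 0 ≤ q → p * p = q * q → p = q := by
    intro p q hp hq h
    have hw : |p - q| ≤ p + q := by
      apply sup_le
      · exact (sub_le_self p hq).trans (le_add_of_nonneg_right hq)
      · rw [neg_sub]; exact (sub_le_self q hp).trans (le_add_of_nonneg_left hp)
    have h0 : (p - q) * (p - q) * (p + q) = 0 := by linear_combination (p - q) * h
    have h1 : (p - q) * (p - q) * |p - q| ≤ 0 := by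
      rw [← h0]; exact mul_le_mul_of_nonneg_left hw (sqnn _)
    have h2 : (p - q) * (p - q) * |p - q| = 0 :=
      le_antisymm h1 (mul_nonneg (sqnn _) (absnn _))
    have h3 : (p - q) * (p - q) = 0 := by
      apply red
      have h5 := abssq (p - q)
      linear_combination (|p - q|) * h2 - (p - q) * (p - q) * h5
    exact sub_eq_zero.mp (red _ h3)
  have abseq : ∀ u v : G, u * u = v * v → |u| = |v| := fun u v h =>
    sqinj _ _ (absnn u) (absnn v) (by rw [abssq, abssq, h])
  have disj : ∀ a b : G, a * b = 0 → D a * D b = 0 := by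
    intro a b hab
    have h1 : D a * b + a * D b = 0 := by rw [← hLeibniz, hab, map_zero]
    have h2 : D a * b = 0 := by
      apply red
      linear_combination D a * b * h1 - D a * D b * hab
    have h3 : D (D a) * b + D a * D b = 0 := by rw [← hLeibniz, h2, map_zero]
    apply red
    linear_combination D a * D b * h3 - D (D a) * D b * h2
  have Dabs : ∀ u : G, D |u| * D |u| = D u * D u := by
    intro u
    have h := disj _ _ (hpm u)
    have e1 : D |u| = D u⁺ + D u⁻ := by rw [← habs u, map_add]
    have e2 : D u = D u⁺ - D u⁻ := by rw [← map_sub, hdec u]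
    rw [e1, e2]
    linear_combination 4 * h
  have tent : ∀ e f : G, 0 ≤ e → D e = 0 → (∀ x : G, |x| ≤ e → |D x| ≤ f) →
      ∀ n : ℕ, ∀ x : G, |x| ≤ e → 2 ^ n • |D x| ≤ f := by
    intro e f he hDe hf n
    induction n with
    | zero => intro x hx; simpa using hf x hx
    | succ n ih =>
      intro x hx
      have hb : |(|x| + |x| - e)| ≤ e := by
        apply sup_le
        · exact sub_le_iff_le_add.mpr (add_le_add hx hx)
        · rw [neg_sub]
          exact sub_le_self e (add_nonneg (absnn x) (absnn x))
      have h1 := ih _ hb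
      have h2 : |D (|x| + |x| - e)| = |D x| + |D x| := by
        apply sqinj _ _ (absnn _) (add_nonneg (absnn _) (absnn _))
        rw [abssq, map_sub, map_add, hDe]
        linear_combination 4 * Dabs x - 4 * abssq (D x)
      rw [h2] at h1
      rw [pow_succ, mul_nsmul', two_nsmul]
      exact h1
  have bdd0 : ∀ e : G, 0 ≤ e → D e = 0 → ∀ x : G, |x| ≤ e → D x = 0 := by
    intro e he hDe x hx
    obtain ⟨f, -, hf⟩ := hbd e he
    apply abszero
    apply arch _ f
    intro n
    exact (nsmul_le_nsmul_left (absnn _) (Nat.lt_two_pow_self).le).trans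
      (tent e f he hDe hf n x hx)
  have D1 : D 1 = 0 := by
    have h := hLeibniz 1 1
    rw [mul_one, mul_one, one_mul] at h
    linear_combination -h
  have key : ∀ x : G, 0 ≤ x → D x = 0 := by
    intro x hx
    obtain ⟨f, -, hf⟩ := hbd (x * x) (sqnn x)
    have main : ∀ n : ℕ, |n • D x| ≤ f := by
      intro n
      have hn : (0 : G) ≤ n • (1 : G) := nsmul_nonneg hone n
      have hDn : D (n • (1 : G)) = 0 := by rw [map_nsmul, D1, nsmul_zero]
      have hp := posPart_nonneg (x - n • (1 : G))
      have hm := negPart_nonneg (x - n • (1 : G))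
      have h0 := hpm (x - n • (1 : G))
      have hd := hdec (x - n • (1 : G))
      have hmn : (x - n • (1 : G))⁻ ≤ n • (1 : G) := by
        rw [negPart_def]
        apply sup_le _ hn
        rw [neg_sub]; exact sub_le_self _ hx
      generalize (x - n • (1 : G))⁺ = p at *
      generalize (x - n • (1 : G))⁻ = m at *
      have hq : 0 ≤ n • (1 : G) - m := sub_nonneg.mpr hmn
      have hDq : D (n • (1 : G) - m) = 0 := by
        apply bdd0 _ hn hDn
        rw [abs_of_nonneg hq]
        exact sub_le_self _ hm
      have hxp : x = p + (n • (1 : G) - m) := by linear_combination -hd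
      have hDx : D x = D p := by rw [hxp, map_add, hDq, add_zero]
      have hnp : n • p = p * (n • (1 : G) - m) := by
        rw [mul_sub, h0, sub_zero, mul_smul_comm, mul_one]
      have hle : |n • p| ≤ x * x := by
        rw [abs_of_nonneg (nsmul_nonneg hp n), hnp]
        have hpq := mul_nonneg hp hq
        have e : x * x = p * (n • (1 : G) - m) + (p * p + p * (n • (1 : G) - m)
            + (n • (1 : G) - m) * (n • (1 : G) - m)) := by
          generalize n • (1 : G) - m = q at *
          rw [hxp]; ring
        rw [e]
        exact le_add_of_nonneg_right (add_nonneg (add_nonneg (sqnn _) hpq) (sqnn _))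
      have := hf _ hle
      rw [map_nsmul] at this
      rw [hDx]; exact this
    apply le_antisymm
    · exact arch _ f fun n => (le_abs_self _).trans (main n)
    · have : -D x ≤ 0 := arch _ f fun n => by
        rw [smul_neg]; exact (neg_le_abs _).trans (main n)
      exact neg_nonpos.mp this
  ext x
  rw [← hdec x, map_sub, key _ (posPart_nonneg x), key _ (negPart_nonneg x)]
  simp
end

section
/- Let (Ω, Σ, μ) be a measure space with μ finite, nonzero, and atomless. Then there exists a sequence (Pₙ) of finite measurable partitions of Ω (each Pₙ is a finite family of pairwise disjoint measurable sets whose union is Ω) such that no measurable set of positive measure is refined modulo null sets from all of them: for every measurable A with μ(A) > 0 there is an n such that μ(A \ U) > 0 for every member U of Pₙ. Consequently, the measure algebra of (Ω, Σ, μ) is not σ-distributive. -/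
open MeasureTheory

/-- A set which is a finite disjoint union of measurable sets of measure at most `ε`. -/
def SmallUnion {Ω : Type*} [MeasurableSpace Ω] (μ : Measure Ω) (ε : ℝ) (A : Set Ω) : Prop :=
  ∃ P : Finset (Set Ω), (∀ U ∈ P, MeasurableSet U ∧ μ.real U ≤ ε) ∧
    ((P : Set (Set Ω)).Pairwise fun U V => U ∩ V = ∅) ∧ ⋃₀ (P : Set (Set Ω)) = A

theorem SmallUnion.measurable {Ω : Type*} [MeasurableSpace Ω] {μ : Measure Ω} {ε : ℝ}
    {A : Set Ω} (h : SmallUnion μ ε A) : MeasurableSet A := by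
  obtain ⟨P, h1, _, rfl⟩ := h
  exact MeasurableSet.sUnion P.countable_toSet (fun U hU => (h1 U hU).1)

theorem SmallUnion.insert {Ω : Type*} [MeasurableSpace Ω] {μ : Measure Ω} {ε : ℝ}
    {A B : Set Ω} (h : SmallUnion μ ε A) (hB : MeasurableSet B) (hs : μ.real B ≤ ε)
    (hd : B ⊆ Aᶜ) : SmallUnion μ ε (B ∪ A) := by
  classical
  obtain ⟨P, h1, h2, rfl⟩ := h
  refine ⟨Insert.insert B P, ?_, ?_, ?_⟩
  · intro U hU
    rcases Finset.mem_insert.1 hU with rfl | hU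
    · exact ⟨hB, hs⟩
    · exact h1 U hU
  · have key : ∀ V ∈ (P : Set (Set Ω)), B ∩ V = ∅ := by
      intro V hV
      ext x
      simp only [Set.mem_inter_iff, Set.mem_empty_iff_false, iff_false, not_and]
      intro hx hxV
      exact hd hx ⟨V, hV, hxV⟩
    rw [Finset.coe_insert]
    refine h2.insert ?_
    intro V hV _
    exact ⟨key V hV, by rw [Set.inter_comm]; exact key V hV⟩
  · simp

theorem exists_small_subset {Ω : Type*} [MeasurableSpace Ω] (μ : Measure Ω) [IsFiniteMeasure μ]
    (hatomless : ∀ A : Set Ω, MeasurableSet A → μ A ≠ 0 →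
      ∃ B ⊆ A, MeasurableSet B ∧ 0 < μ B ∧ μ B < μ A) (n : ℕ) :
    ∀ A : Set Ω, MeasurableSet A → 0 < μ.real A →
      ∃ B ⊆ A, MeasurableSet B ∧ 0 < μ.real B ∧ 2 ^ n * μ.real B ≤ μ.real A := by
  induction n with
  | zero => intro A hA h; exact ⟨A, subset_rfl, hA, h, by simp⟩
  | succ n ih =>
    intro A hA h
    obtain ⟨C, hCA, hC, hC0, hC1⟩ := ih A hA h
    obtain ⟨B, hBC, hB, hB0, hB1⟩ := hatomless C hC (by
      intro h0; simp [Measure.real, h0] at hC0)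
    have r0 : 0 < μ.real B := ENNReal.toReal_pos hB0.ne' (measure_ne_top _ _)
    have r1 : μ.real B < μ.real C :=
      (ENNReal.toReal_lt_toReal (measure_ne_top _ _) (measure_ne_top _ _)).2 hB1
    have r2 : μ.real (C \ B) = μ.real C - μ.real B := measureReal_diff hBC hB
    have p : (0:ℝ) < 2 ^ n := by positivity
    rw [pow_succ]
    by_cases hh : 2 * μ.real B ≤ μ.real C
    · exact ⟨B, hBC.trans hCA, hB, r0, by nlinarith⟩
    · refine ⟨C \ B, Set.diff_subset.trans hCA, hC.diff hB, by linarith, ?_⟩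
      rw [r2]; nlinarith

theorem smallUnion_univ {Ω : Type*} [MeasurableSpace Ω] (μ : Measure Ω) [IsFiniteMeasure μ]
    (hatomless : ∀ A : Set Ω, MeasurableSet A → μ A ≠ 0 →
      ∃ B ⊆ A, MeasurableSet B ∧ 0 < μ B ∧ μ B < μ A) (ε : ℝ) (hε : 0 < ε) :
    SmallUnion μ ε Set.univ := by
  by_contra hcon
  have hbig : ∀ A, SmallUnion μ ε A → ε < μ.real Aᶜ := by
    intro A hA
    by_contra! h
    apply hcon
    have := hA.insert hA.measurable.compl h subset_rfl
    rwa [Set.compl_union_self] at this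
  have step : ∀ A : {A // SmallUnion μ ε A}, ∃ A' : {A // SmallUnion μ ε A}, A.1 ⊆ A'.1 ∧
      ∀ C ⊆ A.1ᶜ, MeasurableSet C → μ.real C ≤ ε →
        μ.real C ≤ 2 * (μ.real A'.1 - μ.real A.1) := by
    rintro ⟨A, hA⟩
    let S : Set ℝ := {r | ∃ C ⊆ Aᶜ, MeasurableSet C ∧ μ.real C ≤ ε ∧ μ.real C = r}
    have hS0 : (0:ℝ) ∈ S := ⟨∅, Set.empty_subset _, MeasurableSet.empty, by simpa using hε.le, by simp⟩
    have hSb : BddAbove S := ⟨ε, by rintro r ⟨C, _, _, h, rfl⟩; exact h⟩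
    have hB : ∃ B ⊆ Aᶜ, MeasurableSet B ∧ μ.real B ≤ ε ∧ sSup S ≤ 2 * μ.real B := by
      by_cases h : sSup S ≤ 0
      · exact ⟨∅, Set.empty_subset _, MeasurableSet.empty, by simpa using hε.le, by simpa using h⟩
      · push Not at h
        obtain ⟨r, ⟨C, h1, h2, h3, rfl⟩, h4⟩ :=
          exists_lt_of_lt_csSup ⟨0, hS0⟩ (show sSup S / 2 < sSup S by linarith)
        exact ⟨C, h1, h2, h3, by linarith⟩
    obtain ⟨B, h1, h2, h3, h4⟩ := hB
    refine ⟨⟨B ∪ A, hA.insert h2 h3 h1⟩, Set.subset_union_right, ?_⟩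
    intro C hC hCm hCs
    have : μ.real (B ∪ A) = μ.real B + μ.real A :=
      measureReal_union (Set.disjoint_left.2 fun x hx => h1 hx) hA.measurable
    have h5 : μ.real C ≤ sSup S := le_csSup hSb ⟨C, hC, hCm, hCs, rfl⟩
    simp only [this]
    linarith
  choose f hf1 hf2 using step
  have h0 : SmallUnion μ ε (∅ : Set Ω) := ⟨∅, by simp, by simp, by simp⟩
  let a : ℕ → {A // SmallUnion μ ε A} := fun n => f^[n] ⟨∅, h0⟩
  have ha : ∀ n, a (n+1) = f (a n) := fun n => Function.iterate_succ_apply' f n _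
  have hmono : Monotone fun n => (a n).1 := monotone_nat_of_le_succ fun n => by
    rw [ha]; exact hf1 _
  let R : Set Ω := ⋂ n, (a n).1ᶜ
  have hRm : MeasurableSet R := MeasurableSet.iInter fun n => (a n).2.measurable.compl
  have hlim := tendsto_measure_iInter_atTop (μ := μ) (s := fun n => (a n).1ᶜ)
    (fun n => (a n).2.measurable.compl.nullMeasurableSet)
    (fun i j h => Set.compl_subset_compl.2 (hmono h)) ⟨0, measure_ne_top _ _⟩
  have hR : ENNReal.ofReal ε ≤ μ R := by
    refine ge_of_tendsto' hlim fun n => ?_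
    exact (ENNReal.ofReal_le_iff_le_toReal (measure_ne_top _ _)).2 (hbig _ (a n).2).le
  have hR0 : 0 < μ.real R :=
    hε.trans_le ((ENNReal.ofReal_le_iff_le_toReal (measure_ne_top _ _)).1 hR)
  obtain ⟨k, hk⟩ := pow_unbounded_of_one_lt (μ.real R / ε) (one_lt_two)
  obtain ⟨C, hCR, hCm, hC0, hC1⟩ := exists_small_subset μ hatomless k R hRm hR0
  have hCε : μ.real C ≤ ε := by
    rw [div_lt_iff₀ hε] at hk
    have p : (0:ℝ) < 2 ^ k := by positivity
    exact le_of_mul_le_mul_left (hC1.trans hk.le) p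
  have hgrow : ∀ n : ℕ, n * μ.real C ≤ 2 * μ.real (a n).1 := by
    intro n
    induction n with
    | zero => simp
    | succ n ih =>
      have := hf2 (a n) C (hCR.trans (Set.iInter_subset _ n)) hCm hCε
      rw [ha]; push_cast; linarith
  obtain ⟨n, hn⟩ := exists_nat_gt (2 * μ.real Set.univ / μ.real C)
  rw [div_lt_iff₀ hC0] at hn
  have := hgrow n
  have : μ.real (a n).1 ≤ μ.real Set.univ := measureReal_mono (Set.subset_univ _)
  linarith

/-- 5.3.3: for a finite nonzero atomless measure there is a sequence of finite
measurable partitions from which no set of positive measure can be refined modulo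
null sets; hence the measure algebra is not σ-distributive. -/
theorem exists_partitions_not_refinable
    {Ω : Type*} [MeasurableSpace Ω] (μ : Measure Ω) [IsFiniteMeasure μ]
    (hne : μ Set.univ ≠ 0)
    (hatomless : ∀ A : Set Ω, MeasurableSet A → μ A ≠ 0 →
      ∃ B ⊆ A, MeasurableSet B ∧ 0 < μ B ∧ μ B < μ A) :
    ∃ P : ℕ → Finset (Set Ω),
      (∀ n, (∀ U ∈ P n, MeasurableSet U) ∧
        ((P n : Set (Set Ω)).Pairwise fun U V => U ∩ V = ∅) ∧
        ⋃₀ (P n : Set (Set Ω)) = Set.univ) ∧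
      ∀ A : Set Ω, MeasurableSet A → 0 < μ A →
        ∃ n, ∀ U ∈ P n, 0 < μ (A \ U) := by
  have h := fun n : ℕ => smallUnion_univ μ hatomless (1 / ((n : ℝ) + 1)) (by positivity)
  choose P h1 h2 h3 using h
  refine ⟨P, fun n => ⟨fun U hU => (h1 n U hU).1, h2 n, h3 n⟩, ?_⟩
  intro A hA hA0
  have r0 : 0 < μ.real A := ENNReal.toReal_pos hA0.ne' (measure_ne_top _ _)
  obtain ⟨n, hn⟩ := exists_nat_one_div_lt r0
  refine ⟨n, fun U hU => ?_⟩
  have hlt : μ U < μ A :=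
    (ENNReal.toReal_lt_toReal (measure_ne_top _ _) (measure_ne_top _ _)).1
      ((h1 n U hU).2.trans_lt hn)
  exact (tsub_pos_of_lt hlt).trans_le le_measure_diff
end

section
/- Let (Ω, Σ, μ) be a σ-finite measure space with μ nonzero and atomless. Then there exists a nonzero ℝ-linear derivation on the algebra L⁰(μ) of (equivalence classes modulo μ-a.e. equality of) real-valued measurable functions on Ω: an ℝ-linear map D : L⁰(μ) → L⁰(μ) with D ≠ 0 and D(u·v) = D(u)·v + u·D(v) for all u, v ∈ L⁰(μ). -/
section
open MeasureTheory Polynomial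
open scoped TensorProduct

open scoped IntermediateField.algebraAdjoinAdjoin in
lemma formallyEtale_aux_s19 {K L ι : Type*} [Field L] [Field K] [Algebra K L] [CharZero K] {v : ι → L}
    (hb : IsTranscendenceBasis K v) :
    Algebra.FormallyEtale (Algebra.adjoin K (Set.range v)) L := by
  have h1 : Algebra.FormallyEtale (Algebra.adjoin K (Set.range v))
      (IntermediateField.adjoin K (Set.range v)) :=
    .of_isLocalization (nonZeroDivisors _)
  have h2 : Algebra.IsAlgebraic (IntermediateField.adjoin K (Set.range v)) L :=
    hb.isAlgebraic_field
  have h4 : CharZero (IntermediateField.adjoin K (Set.range v)) := charZero_of_injective_algebraMap (algebraMap K _).injective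
  have h3 : Algebra.FormallyEtale (IntermediateField.adjoin K (Set.range v)) L :=
    Algebra.FormallyEtale.of_isSeparable _ L
  exact .comp _ (IntermediateField.adjoin K (Set.range v)) _

lemma field_D_ne_zero {K L : Type*} [Field L] [Field K] [Algebra K L] [CharZero K] (t : L)
    (ht : Transcendental K t) : KaehlerDifferential.D K L t ≠ 0 := by
  have hs : AlgebraicIndepOn K id ({t} : Set L) := by
    exact (algebraicIndependent_unique_type_iff (ι := ({t} : Set L))).mpr ht
  obtain ⟨s, hts, hb⟩ := exists_isTranscendenceBasis_superset hs
  let v : s → L := (↑)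
  have hb : IsTranscendenceBasis K v := hb
  have hE := formallyEtale_aux_s19 hb
  let A := MvPolynomial s K
  let S := Algebra.adjoin K (Set.range v)
  let e : A ≃ₐ[K] S := hb.1.aevalEquiv
  let : Algebra A S := e.toRingHom.toAlgebra
  let : Algebra A L := ((algebraMap S L).comp e.toRingHom).toAlgebra
  have : IsScalarTower A S L := .of_algebraMap_eq fun _ => rfl
  have : IsScalarTower K A L := .of_algebraMap_eq fun r => by
    change _ = algebraMap S L (e (algebraMap K A r))
    rw [e.commutes]; rfl
  have h1 : Algebra.FormallyEtale A S := .of_equiv (AlgEquiv.ofBijective (Algebra.ofId A S) e.bijective)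
  have h2 : Algebra.FormallyEtale A L := .comp A S L
  let b := (KaehlerDifferential.mvPolynomialBasis K s).baseChange L
  have h3 := b.ne_zero ⟨t, hts rfl⟩
  intro h
  apply h3
  apply (KaehlerDifferential.tensorKaehlerEquivOfFormallyEtale K A L).injective
  rw [map_zero]
  rw [← h]
  simp [b, KaehlerDifferential.mvPolynomialBasis_apply]
  refine (KaehlerDifferential.mapBaseChange_tmul K A L _ _).trans ?_
  rw [one_smul, KaehlerDifferential.map_D]
  congr 1
  change algebraMap S L (e (MvPolynomial.X _)) = t
  refine (hb.1.algebraMap_aevalEquiv _).trans ?_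
  simp [v]

lemma alg_main {R : Type*} [CommRing R] [Nontrivial R] [Algebra ℝ R] (hB : Module.Baer R R)
    (hreg : ∀ r : R, ∃ s, r * s * r = r) (x : R)
    (hx : ∀ p : ℝ[X], p ≠ 0 → IsUnit (aeval x p)) : ∃ D : Derivation ℝ R R, D ≠ 0 := by
  have key : ∀ r : R, r • KaehlerDifferential.D ℝ R x = 0 → r = 0 := by
    intro r hr
    by_contra h0
    obtain ⟨s, hs⟩ := hreg r
    have hnu : ¬ IsUnit (1 - r * s) := by
      intro hu
      apply h0
      apply hu.mul_left_cancel
      linear_combination -hs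
    obtain ⟨m, hm, hmem⟩ := exists_max_ideal_of_mem_nonunits hnu
    let : Field (R ⧸ m) := Ideal.Quotient.field m
    have hrm : (Ideal.Quotient.mk m r) ≠ 0 := by
      intro h
      have h1 := Ideal.Quotient.eq_zero_iff_mem.mpr hmem
      simp [h] at h1
    have ht : Transcendental ℝ (Ideal.Quotient.mk m x) := by
      rw [transcendental_iff]
      intro p hp
      by_contra hp0
      have := (hx p hp0).map (Ideal.Quotient.mkₐ ℝ m)
      rw [← Polynomial.aeval_algHom_apply] at this
      exact this.ne_zero hp
    have hD := field_D_ne_zero _ ht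
    have := congrArg (KaehlerDifferential.map ℝ ℝ R (R ⧸ m)) hr
    rw [map_smul, KaehlerDifferential.map_D, map_zero] at this
    rw [← algebraMap_smul (R ⧸ m) r] at this
    exact (smul_ne_zero hrm hD) this
  obtain ⟨h, hh⟩ := hB.extension_property (LinearMap.toSpanSingleton R _ (KaehlerDifferential.D ℝ R x))
    (by
      rw [← LinearMap.ker_eq_bot, LinearMap.ker_eq_bot']
      exact key) LinearMap.id
  refine ⟨h.compDer (KaehlerDifferential.D ℝ R), fun h0 => ?_⟩
  have h1 := congrArg (fun d => d x) h0
  have h2 := congrArg (fun f => f 1) hh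
  simp at h1 h2
  simp [h1] at h2
end

section
open MeasureTheory Set Filter

/-- Exhaustion. -/
lemma exhaustion {Ω : Type*} [MeasurableSpace Ω] (ν : Measure Ω) [IsFiniteMeasure ν]
    (P : Set (Set Ω)) (hP : ∀ A ∈ P, MeasurableSet A) (hne : P.Nonempty) :
    ∃ S : ℕ → Set Ω, (∀ n, S n ∈ P) ∧ ∀ A ∈ P, ν (A \ ⋃ n, S n) = 0 := by
  let Q : Set (ℕ → Set Ω) := {S | ∀ n, S n ∈ P}
  let f : (ℕ → Set Ω) → ENNReal := fun S => ν (⋃ n, S n)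
  have hQ : (f '' Q).Nonempty := by
    obtain ⟨A, hA⟩ := hne
    exact ⟨_, fun _ => A, fun _ => hA, rfl⟩
  obtain ⟨u, -, hu, huQ⟩ := exists_seq_tendsto_sSup hQ (OrderTop.bddAbove _)
  choose T hT hTu using huQ
  let S : ℕ → Set Ω := fun n => T n.unpair.1 n.unpair.2
  have hS : S ∈ Q := fun n => hT _ _
  have hTS : ∀ k, (⋃ n, T k n) ⊆ ⋃ n, S n := by
    intro k
    refine iUnion_subset fun n => ?_
    refine subset_iUnion_of_subset (Nat.pair k n) ?_
    simp [S]
  have hmax : sSup (f '' Q) ≤ ν (⋃ n, S n) := by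
    refine le_of_tendsto' hu fun k => ?_
    rw [← hTu]
    exact measure_mono (hTS k)
  refine ⟨S, hS, fun A hA => ?_⟩
  let S' : ℕ → Set Ω := fun n => Nat.casesOn n A S
  have hS' : S' ∈ Q := by
    intro n
    cases n with
    | zero => exact hA
    | succ n => exact hS n
  have hU : (⋃ n, S' n) = (⋃ n, S n) ∪ (A \ ⋃ n, S n) := by
    rw [union_sdiff_self, union_comm]
    ext ω
    simp only [mem_iUnion, mem_union]
    constructor
    · rintro ⟨_ | n, h⟩
      · exact Or.inl h
      · exact Or.inr ⟨n, h⟩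
    · rintro (h | ⟨n, h⟩)
      · exact ⟨0, h⟩
      · exact ⟨n + 1, h⟩
  have h1 : ν (⋃ n, S' n) ≤ ν (⋃ n, S n) := (le_sSup (a := f S') (mem_image_of_mem f hS')).trans hmax
  have hm : MeasurableSet (⋃ n, S n) := MeasurableSet.iUnion fun n => hP _ (hS n)
  rw [hU, measure_union disjoint_sdiff_right ((hP _ hA).diff hm)] at h1
  by_contra h0
  exact absurd h1 (not_le.mpr (ENNReal.lt_add_right (measure_ne_top _ _) h0))

lemma exists_small {Ω : Type*} [MeasurableSpace Ω] (ν : Measure Ω) [IsFiniteMeasure ν]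
    (hsplit : ∀ A : Set Ω, MeasurableSet A → ν A ≠ 0 →
      ∃ B ⊆ A, MeasurableSet B ∧ ν B ≠ 0 ∧ ν (A \ B) ≠ 0)
    (A : Set Ω) (hA : MeasurableSet A) (h0 : ν A ≠ 0) (ε : ENNReal) (hε : ε ≠ 0) :
    ∃ B ⊆ A, MeasurableSet B ∧ ν B ≠ 0 ∧ ν B ≤ ε := by
  have half : ∀ A : Set Ω, MeasurableSet A → ν A ≠ 0 →
      ∃ B ⊆ A, MeasurableSet B ∧ ν B ≠ 0 ∧ 2 * ν B ≤ ν A := by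
    intro A hA h0
    obtain ⟨B, hBA, hB, hB0, hB1⟩ := hsplit A hA h0
    have hadd : ν B + ν (A \ B) = ν A := by
      rw [measure_add_sdiff hB.nullMeasurableSet, union_eq_self_of_subset_left hBA]
    rcases le_total (ν B) (ν (A \ B)) with h | h
    · exact ⟨B, hBA, hB, hB0, by rw [two_mul, ← hadd]; gcongr⟩
    · exact ⟨A \ B, sdiff_subset, hA.diff hB, hB1, by rw [two_mul, ← hadd]; gcongr⟩
  have iter : ∀ n : ℕ, ∃ B ⊆ A, MeasurableSet B ∧ ν B ≠ 0 ∧ 2 ^ n * ν B ≤ ν A := by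
    intro n
    induction n with
    | zero => exact ⟨A, subset_rfl, hA, h0, by simp⟩
    | succ n ih =>
      obtain ⟨B, hBA, hB, hB0, hle⟩ := ih
      obtain ⟨C, hCB, hC, hC0, hle'⟩ := half B hB hB0
      refine ⟨C, hCB.trans hBA, hC, hC0, ?_⟩
      rw [pow_succ, mul_assoc]
      exact le_trans (by gcongr) hle
  obtain ⟨n, hn⟩ := ENNReal.exists_nat_mul_gt hε (measure_ne_top ν A)
  obtain ⟨B, hBA, hB, hB0, hle⟩ := iter n
  refine ⟨B, hBA, hB, hB0, ?_⟩
  by_contra hlt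
  push Not at hlt
  have : (n : ENNReal) * ε ≤ 2 ^ n * ν B := by
    gcongr
    exact_mod_cast Nat.lt_two_pow_self.le
  exact absurd (this.trans hle) (not_le.mpr hn)

lemma exists_diffuse {Ω : Type*} [MeasurableSpace Ω] (ν : Measure Ω) [IsFiniteMeasure ν]
    (hsplit : ∀ A : Set Ω, MeasurableSet A → ν A ≠ 0 →
      ∃ B ⊆ A, MeasurableSet B ∧ ν B ≠ 0 ∧ ν (A \ B) ≠ 0) :
    ∃ x : Ω → ℝ, Measurable x ∧ ∀ c, ν (x ⁻¹' {c}) = 0 := by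
  have h1 : ∀ k : ℕ, ∃ S : ℕ → Set Ω, (∀ n, MeasurableSet (S n) ∧ ν (S n) ≤ ((k : ENNReal) + 1)⁻¹) ∧
      ν (⋃ n, S n)ᶜ = 0 := by
    intro k
    obtain ⟨S, hS, hA⟩ := exhaustion ν {B | MeasurableSet B ∧ ν B ≤ ((k : ENNReal) + 1)⁻¹}
      (fun _ h => h.1) ⟨∅, by simp⟩
    refine ⟨S, hS, ?_⟩
    by_contra h0
    obtain ⟨B, hB, hBm, hB0, hle⟩ := exists_small ν hsplit _
      (MeasurableSet.iUnion fun n => (hS n).1).compl h0 ((k : ENNReal) + 1)⁻¹ (by simp)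
    apply hB0
    have := hA B ⟨hBm, hle⟩
    rwa [(subset_compl_iff_disjoint_right.mp hB).sdiff_eq_left] at this
  choose S hS hS0 using h1
  classical
  let g : Ω → (ℕ × ℕ → Bool) := fun ω i => decide (ω ∈ S i.1 i.2)
  have hg : Measurable g := by
    refine measurable_pi_lambda _ fun i => ?_
    refine measurable_to_bool ?_
    convert (hS i.1 i.2).1 using 1
    ext ω; simp [g]
  refine ⟨embeddingReal _ ∘ g, (measurable_embeddingReal _).comp hg, fun c => ?_⟩
  have hb : ∀ k : ℕ, ν ((embeddingReal _ ∘ g) ⁻¹' {c}) ≤ ((k : ENNReal) + 1)⁻¹ := by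
    intro k
    by_cases h : (embeddingReal _ ∘ g) ⁻¹' {c} ⊆ (⋃ n, S k n)ᶜ
    · rw [measure_mono_null h (hS0 k)]; simp
    · rw [not_subset] at h
      obtain ⟨ω, hω, hω'⟩ := h
      simp only [mem_compl_iff, not_not, mem_iUnion] at hω'
      obtain ⟨n, hn⟩ := hω'
      refine (measure_mono ?_).trans (hS k n).2
      intro ω' h'
      have : g ω' = g ω := (measurableEmbedding_embeddingReal _).injective (h'.trans hω.symm)
      have := congrFun this (k, n)
      simpa [g, hn] using this
  have hlim : Tendsto (fun k : ℕ => ((k : ENNReal) + 1)⁻¹) atTop (nhds 0) := by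
    have := (tendsto_add_atTop_iff_nat 1).mpr ENNReal.tendsto_inv_nat_nhds_zero
    simpa using this
  exact le_antisymm (ge_of_tendsto' hlim hb) bot_le

lemma split_of_atomless {Ω : Type*} [MeasurableSpace Ω] (μ : Measure Ω) [SigmaFinite μ]
    (hatomless : ∀ A : Set Ω, MeasurableSet A → μ A ≠ 0 →
      ∃ B ⊆ A, MeasurableSet B ∧ 0 < μ B ∧ μ B < μ A)
    (A : Set Ω) (hA : MeasurableSet A) (h0 : μ A ≠ 0) :
      ∃ B ⊆ A, MeasurableSet B ∧ μ B ≠ 0 ∧ μ (A \ B) ≠ 0 := by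
  obtain ⟨B, hBA, hB, hB0, hlt⟩ := hatomless A hA h0
  refine ⟨B, hBA, hB, hB0.ne', fun h => ?_⟩
  have := measure_add_sdiff (μ := μ) hB.nullMeasurableSet A
  rw [union_eq_self_of_subset_left hBA, h, add_zero] at this
  exact hlt.ne this
end

section
open MeasureTheory Set Filter Polynomial

namespace L0aux
variable {Ω : Type*} [MeasurableSpace Ω] {μ : Measure Ω}

/-- ring structure on `L⁰` -/
noncomputable abbrev ring (μ : Measure Ω) : CommRing (Ω →ₘ[μ] ℝ) :=
  { (inferInstance : AddCommGroup (Ω →ₘ[μ] ℝ)), (inferInstance : CommMonoid (Ω →ₘ[μ] ℝ)) with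
    left_distrib := fun a b c => by
      induction a using AEEqFun.induction_on
      induction b using AEEqFun.induction_on
      induction c using AEEqFun.induction_on
      simp only [AEEqFun.mk_add_mk, AEEqFun.mk_mul_mk, mul_add]
    right_distrib := fun a b c => by
      induction a using AEEqFun.induction_on
      induction b using AEEqFun.induction_on
      induction c using AEEqFun.induction_on
      simp only [AEEqFun.mk_add_mk, AEEqFun.mk_mul_mk, add_mul]
    zero_mul := fun a => by
      induction a using AEEqFun.induction_on
      simp only [AEEqFun.zero_def, AEEqFun.mk_mul_mk]
      congr 1; ext; simp
    mul_zero := fun a => by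
      induction a using AEEqFun.induction_on
      simp only [AEEqFun.zero_def, AEEqFun.mk_mul_mk]
      congr 1; ext; simp }

attribute [local instance] ring

noncomputable abbrev alg (μ : Measure Ω) : Algebra ℝ (Ω →ₘ[μ] ℝ) :=
  Algebra.ofModule
    (fun r a b => by
      induction a using AEEqFun.induction_on
      induction b using AEEqFun.induction_on
      simp only [AEEqFun.smul_mk, AEEqFun.mk_mul_mk, smul_mul_assoc])
    (fun r a b => by
      induction a using AEEqFun.induction_on
      induction b using AEEqFun.induction_on
      simp only [AEEqFun.smul_mk, AEEqFun.mk_mul_mk, mul_smul_comm])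

attribute [local instance] alg

lemma regular (r : Ω →ₘ[μ] ℝ) : ∃ s, r * s * r = r := by
  refine ⟨AEEqFun.mk (fun ω => (r ω)⁻¹) (r.measurable.inv.aestronglyMeasurable), ?_⟩
  apply AEEqFun.ext
  filter_upwards [AEEqFun.coeFn_mul (r * AEEqFun.mk (fun ω => (r ω)⁻¹) (r.measurable.inv.aestronglyMeasurable)) r,
    AEEqFun.coeFn_mul r (AEEqFun.mk (fun ω => (r ω)⁻¹) (r.measurable.inv.aestronglyMeasurable)),
    AEEqFun.coeFn_mk (μ := μ) (fun ω => (r ω)⁻¹) (r.measurable.inv.aestronglyMeasurable)] with ω h1 h2 h3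
  rw [h1, Pi.mul_apply, h2, Pi.mul_apply, h3]
  exact mul_inv_mul_cancel _

lemma aeval_mk (x : Ω → ℝ) (hx : Measurable x) (p : ℝ[X]) :
    aeval (AEEqFun.mk x hx.aestronglyMeasurable : Ω →ₘ[μ] ℝ) p =
      AEEqFun.mk (fun ω => p.eval (x ω)) (p.continuous.measurable.comp hx).aestronglyMeasurable := by
  induction p using Polynomial.induction_on' with
  | add p q hp hq =>
    rw [map_add, hp, hq, AEEqFun.mk_add_mk]
    congr 1; ext; simp
  | monomial n a =>
    rw [aeval_monomial, ← Algebra.smul_def, AEEqFun.mk_pow, AEEqFun.smul_mk]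
    congr 1; ext; simp

lemma isUnit_aeval (x : Ω → ℝ) (hx : Measurable x) (h0 : ∀ c, μ (x ⁻¹' {c}) = 0)
    (p : ℝ[X]) (hp : p ≠ 0) :
    IsUnit (aeval (AEEqFun.mk x hx.aestronglyMeasurable : Ω →ₘ[μ] ℝ) p) := by
  rw [aeval_mk x hx]
  refine IsUnit.of_mul_eq_one (AEEqFun.mk (fun ω => (p.eval (x ω))⁻¹)
    (p.continuous.measurable.comp hx).inv.aestronglyMeasurable) ?_
  rw [AEEqFun.mk_mul_mk, AEEqFun.one_def, AEEqFun.mk_eq_mk]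
  have : ∀ᵐ ω ∂μ, ∀ c ∈ p.roots.toFinset, x ω ≠ c := by
    rw [Finset.eventually_all]
    intro c _
    rw [ae_iff]
    convert h0 c using 2
    ext; simp
  filter_upwards [this] with ω hω
  have : p.eval (x ω) ≠ 0 := by
    intro h
    exact hω (x ω) (by simp [hp, h]) rfl
  simp [this]

/-- class of indicator -/
noncomputable def ind (μ : Measure Ω) (A : Set Ω) (hA : MeasurableSet A) : Ω →ₘ[μ] ℝ :=
  AEEqFun.mk (A.indicator 1) (measurable_one.indicator hA).aestronglyMeasurable

lemma coe_ind (A : Set Ω) (hA : MeasurableSet A) : ind μ A hA =ᵐ[μ] A.indicator 1 :=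
  AEEqFun.coeFn_mk _ _

lemma baer [SigmaFinite μ] : Module.Baer (Ω →ₘ[μ] ℝ) (Ω →ₘ[μ] ℝ) := by
  intro I g
  obtain ⟨S, hS, hmax⟩ := exhaustion μ.toFinite {A | ∃ hA : MeasurableSet A, ind μ A hA ∈ I}
    (fun A hA => hA.1) ⟨∅, MeasurableSet.empty, by
      convert I.zero_mem
      apply AEEqFun.ext
      filter_upwards [coe_ind (μ := μ) ∅ MeasurableSet.empty, AEEqFun.coeFn_zero (μ := μ) (β := ℝ)] with ω h1 h2
      rw [h1, h2]; simp⟩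
  choose hm hI using hS
  -- on each `S n`, any element of `I` is sent to its product with the value at the indicator
  have hloc : ∀ n, ∀ a (ha : a ∈ I), ∀ᵐ ω ∂μ, ω ∈ S n → g ⟨a, ha⟩ ω = a ω * g ⟨_, hI n⟩ ω := by
    intro n a ha
    have h : ind μ (S n) (hm n) * g ⟨a, ha⟩ = a * g ⟨_, hI n⟩ := by
      rw [← smul_eq_mul, ← smul_eq_mul, ← map_smul, ← map_smul]
      congr 1
      ext1
      simp [mul_comm]
    have h' := AEEqFun.coeFn_mul (ind μ (S n) (hm n)) (g ⟨a, ha⟩)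
    rw [h] at h'
    filter_upwards [h', AEEqFun.coeFn_mul a (g ⟨_, hI n⟩), coe_ind (μ := μ) (S n) (hm n)]
      with ω h1 h2 h3 hω
    rw [h2] at h1
    simpa [h3, hω] using h1.symm
  obtain ⟨f, hf, hfS⟩ := exists_measurable_piecewise (disjointed S)
    (fun n => MeasurableSet.disjointed hm n) (fun n => (g ⟨_, hI n⟩ : Ω → ℝ))
    (fun n => (g ⟨_, hI n⟩).measurable) (fun i j hij ω hω =>
      absurd hω (Set.disjoint_left.mp (disjoint_disjointed S hij) hω.1 |> fun h h' => h h'.2))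
  refine ⟨LinearMap.mulRight _ (AEEqFun.mk f hf.aestronglyMeasurable), fun a ha => ?_⟩
  rw [LinearMap.mulRight_apply]
  -- the support of `a`
  have hsm : MeasurableSet {ω | a ω ≠ 0} := a.measurable (measurableSet_singleton 0).compl
  have hsupp : ind μ {ω | a ω ≠ 0} hsm ∈ I := by
    convert I.mul_mem_right (AEEqFun.mk (fun ω => (a ω)⁻¹) (a.measurable.inv.aestronglyMeasurable)) ha
    apply AEEqFun.ext
    filter_upwards [coe_ind (μ := μ) _ hsm,
      AEEqFun.coeFn_mul a (AEEqFun.mk (fun ω => (a ω)⁻¹) (a.measurable.inv.aestronglyMeasurable)),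
      AEEqFun.coeFn_mk (μ := μ) (fun ω => (a ω)⁻¹) (a.measurable.inv.aestronglyMeasurable)] with ω h1 h2 h3
    rw [h1, h2, Pi.mul_apply, h3]
    by_cases h : a ω = 0 <;> simp [h]
  have hnull := hmax _ ⟨hsm, hsupp⟩
  rw [toFinite_apply_eq_zero_iff] at hnull
  -- `g a` vanishes where `a` does
  have hga : ind μ {ω | a ω ≠ 0} hsm * g ⟨a, ha⟩ = g ⟨a, ha⟩ := by
    rw [← smul_eq_mul, ← map_smul]
    congr 1
    ext1
    change ind μ {ω | a ω ≠ 0} hsm * a = a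
    apply AEEqFun.ext
    filter_upwards [coe_ind (μ := μ) _ hsm, AEEqFun.coeFn_mul (ind μ {ω | a ω ≠ 0} hsm) a] with ω h1 h2
    rw [h2, Pi.mul_apply, h1]
    by_cases h : a ω = 0 <;> simp [h]
  have hga' := AEEqFun.coeFn_mul (ind μ {ω | a ω ≠ 0} hsm) (g ⟨a, ha⟩)
  rw [hga] at hga'
  apply AEEqFun.ext
  have hloc' := ae_all_iff.mpr fun n => hloc n a ha
  have hnull' : ∀ᵐ ω ∂μ, ω ∉ {ω | a ω ≠ 0} \ ⋃ n, S n := measure_eq_zero_iff_ae_notMem.mp hnull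
  filter_upwards [AEEqFun.coeFn_mul a (AEEqFun.mk f hf.aestronglyMeasurable),
    AEEqFun.coeFn_mk (μ := μ) f hf.aestronglyMeasurable, hga', coe_ind (μ := μ) _ hsm, hloc', hnull']
    with ω h1 h2 h3 h4 h5 h6
  rw [h1, Pi.mul_apply, h2]
  by_cases h : a ω = 0
  · rw [h3]; simp [h4, h]
  · have hU : ω ∈ ⋃ n, S n := by
      by_contra hU
      exact h6 ⟨h, hU⟩
    rw [← iUnion_disjointed] at hU
    obtain ⟨n, hn⟩ := mem_iUnion.mp hU
    rw [hfS n hn, h5 n (disjointed_subset S n hn)]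

end L0aux
end

section
open MeasureTheory
attribute [local instance] L0aux.ring L0aux.alg

lemma L0aux.final {Ω : Type*} [MeasurableSpace Ω] (μ : Measure Ω) [SigmaFinite μ]
    (hne : μ ≠ 0)
    (hatomless : ∀ A : Set Ω, MeasurableSet A → μ A ≠ 0 →
      ∃ B ⊆ A, MeasurableSet B ∧ 0 < μ B ∧ μ B < μ A) :
    ∃ D : Derivation ℝ (Ω →ₘ[μ] ℝ) (Ω →ₘ[μ] ℝ), D ≠ 0 := by
  obtain ⟨x, hx, h0⟩ := exists_diffuse μ.toFinite (fun A hA h => by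
    simp only [ne_eq, toFinite_apply_eq_zero_iff] at h ⊢
    exact split_of_atomless μ hatomless A hA h)
  simp only [toFinite_apply_eq_zero_iff] at h0
  have : NeZero μ := ⟨hne⟩
  have : Nontrivial (Ω →ₘ[μ] ℝ) := by
    refine ⟨0, 1, fun h => ?_⟩
    obtain ⟨ω⟩ := Measure.nonempty_of_neZero μ
    have h1 : (0 : Ω →ₘ[μ] ℝ) ω = (1 : Ω →ₘ[μ] ℝ) ω := by rw [h]
    rw [AEEqFun.coeFn_one_eq, AEEqFun.coeFn_zero_eq] at h1
    exact zero_ne_one h1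
  exact alg_main L0aux.baer L0aux.regular _ (L0aux.isUnit_aeval x hx h0)

end

open MeasureTheory

/-- 5.3.5(1): on the algebra `L⁰(μ)` of (classes of) real measurable functions
over a σ-finite nonzero atomless measure there exists a nonzero ℝ-linear
derivation. -/
theorem exists_nontrivial_derivation_L0
    {Ω : Type*} [MeasurableSpace Ω] (μ : Measure Ω) [SigmaFinite μ]
    (hne : μ ≠ 0)
    (hatomless : ∀ A : Set Ω, MeasurableSet A → μ A ≠ 0 →
      ∃ B ⊆ A, MeasurableSet B ∧ 0 < μ B ∧ μ B < μ A) :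
    ∃ D : (Ω →ₘ[μ] ℝ) → (Ω →ₘ[μ] ℝ),
      (∀ u v : Ω →ₘ[μ] ℝ, D (u + v) = D u + D v) ∧
      (∀ (c : ℝ) (u : Ω →ₘ[μ] ℝ), D (c • u) = c • D u) ∧
      D ≠ 0 ∧
      ∀ u v : Ω →ₘ[μ] ℝ, D (u * v) = D u * v + u * D v := by

  let _ := L0aux.ring μ
  let _ := L0aux.alg μ
  obtain ⟨D, hD⟩ := L0aux.final μ hne hatomless
  refine ⟨fun u => D u, fun u v => D.map_add u v, fun c u => D.map_smul c u, fun h => hD ?_,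
    fun u v => ?_⟩
  · exact Derivation.ext fun a => congrFun h a
  · refine (D.leibniz u v).trans ?_
    rw [add_comm, smul_eq_mul, smul_eq_mul, mul_comm v]
end
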